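/- arXiv:math/0605435 — 11 statements merged into one kernel-verified Lean document; each statement's English description precedes it below -/
import Mathlib

section
/- Let P₁ and P₂ be admissible polytopes, with all vertices of P₁ in v₁+M and all vertices of P₂ in v₂+M for some v₁, v₂ ∈ Λ, and assume in addition that no vertex of the Minkowski sum P₁+P₂ lies on any wall H_j. Then (Q(P₁) ∩ (v₁+M)) + (Q(P₂) ∩ (v₂+M)) = Q(P₁+P₂) ∩ (v₁+v₂+M) (Minkowski sum of subsets of V) if and only if (P₁ ∩ (v₁+M)) + (P₂ ∩ (v₂+M)) = (P₁+P₂) ∩ (v₁+v₂+M). -/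
open scoped RealInnerProductSpace Pointwise

/-- The orthogonal reflection `s_α` in the hyperplane orthogonal to `α`:
`s_α (x) = x − ⟨x, α^∨⟩ α` where `α^∨ = 2α/⟨α,α⟩`. -/
noncomputable def reflVec {V : Type*} [NormedAddCommGroup V] [InnerProductSpace ℝ V]
    (α x : V) : V :=
  x - (2 * ⟪x, α⟫ / ⟪α, α⟫) • α

/-- A reduced crystallographic root system `Φ` spanning `V`, together with a fixed base
`α₁, …, α_l` of simple roots. -/
structure RootSystemWithBase (V : Type*) [NormedAddCommGroup V] [InnerProductSpace ℝ V]
    [FiniteDimensional ℝ V] (l : ℕ) where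
  Φ : Set V
  finite : Φ.Finite
  spans : Submodule.span ℝ Φ = ⊤
  nz : ∀ α ∈ Φ, α ≠ 0
  reflMem : ∀ α ∈ Φ, ∀ β ∈ Φ, reflVec α β ∈ Φ
  cryst : ∀ α ∈ Φ, ∀ β ∈ Φ, ∃ n : ℤ, (n : ℝ) = 2 * ⟪β, α⟫ / ⟪α, α⟫
  reduced : ∀ α ∈ Φ, ∀ t : ℝ, t • α ∈ Φ → t = 1 ∨ t = -1
  simple : Fin l → V
  simpleMem : ∀ i, simple i ∈ Φ
  indep : LinearIndependent ℝ simple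
  base : ∀ β ∈ Φ, (∃ c : Fin l → ℝ, (∀ i, 0 ≤ c i) ∧ β = ∑ i, c i • simple i) ∨
      (∃ c : Fin l → ℝ, (∀ i, c i ≤ 0) ∧ β = ∑ i, c i • simple i)

namespace RootSystemWithBase

variable {V : Type*} [NormedAddCommGroup V] [InnerProductSpace ℝ V] [FiniteDimensional ℝ V]
variable {l : ℕ} (R : RootSystemWithBase V l)

/-- The root lattice `M`, the ℤ-span of the roots. -/
def rootLattice : Submodule ℤ V := Submodule.span ℤ R.Φ

/-- The weight lattice `Λ = {x ∈ V : ⟨x, α^∨⟩ ∈ ℤ for all α ∈ Φ}`. -/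
def weightLattice : Set V :=
  {x | ∀ α ∈ R.Φ, ∃ n : ℤ, (n : ℝ) = 2 * ⟪x, α⟫ / ⟪α, α⟫}

/-- The closed dominant chamber `C⁺`. -/
def domChamber : Set V := {x | ∀ i, 0 ≤ ⟪x, R.simple i⟫}

/-- The wall `H_j = {x : ⟨x, α_j⟩ = 0}`. -/
def wall (j : Fin l) : Set V := {x | ⟪x, R.simple j⟫ = 0}

/-- Invariance under the Weyl group `W` (equivalently, invariance under each of the
generating reflections `s_α`, `α ∈ Φ`). -/
def WInvariant (P : Set V) : Prop := ∀ α ∈ R.Φ, ∀ x ∈ P, reflVec α x ∈ P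

/-- `Q(P) = {m : ⟨m,u⟩ ≥ min_{p∈P} ⟨p,u⟩ for every u with ⟨α_i,u⟩ ≤ 0 for all i}`;
since the minimum over the (compact) polytope `P` is attained, `⟨m,u⟩ ≥ min_{p∈P}⟨p,u⟩`
is expressed as `∃ p ∈ P, ⟨p,u⟩ ≤ ⟨m,u⟩`. -/
def Q (P : Set V) : Set V :=
  {m | ∀ u : V, (∀ i, ⟪R.simple i, u⟫ ≤ 0) → ∃ p ∈ P, ⟪p, u⟫ ≤ ⟪m, u⟫}

/-- An admissible polytope: a `W`-invariant polytope all of whose vertices lie in the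
weight lattice and none of whose vertices lies on a wall. -/
def IsAdmissible (P : Set V) : Prop :=
  (∃ S : Set V, S.Finite ∧ S.Nonempty ∧ P = convexHull ℝ S) ∧
  R.WInvariant P ∧
  (∀ v ∈ P.extremePoints ℝ, v ∈ R.weightLattice) ∧
  ∀ j : Fin l, ∀ v ∈ P.extremePoints ℝ, v ∉ R.wall j

end RootSystemWithBase

/-- Strong induction on a nonnegative real quantity dropping by at least `c > 0` at each step. -/
theorem gap_induction {X : Type*} (f : X → ℝ) {c : ℝ} (hc : 0 < c) {p : X → Prop}
    (h : ∀ x, (∀ y, 0 ≤ f y → f y ≤ f x - c → p y) → p x) (x : X) : p x := by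
  induction hn : ⌊f x / c⌋₊ using Nat.strong_induction_on generalizing x with
  | _ n ih =>
    refine h x fun y hy hyx => ih _ ?_ y rfl
    have h1 : f y / c + 1 ≤ f x / c := by
      rw [← div_self hc.ne', ← add_div]
      gcongr
      linarith
    have h2 := Nat.floor_le_floor h1
    rw [Nat.floor_add_one (by positivity)] at h2
    omega

theorem extremePoints_add_subset {E : Type*} [AddCommGroup E] [Module ℝ E] (A B : Set E) :
    (A + B).extremePoints ℝ ⊆ A.extremePoints ℝ + B.extremePoints ℝ := by
  rintro _ ⟨⟨a, ha, b, hb, rfl⟩, hx⟩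
  refine ⟨a, ⟨ha, fun y hy z hz hyz => ?_⟩, b, ⟨hb, fun y hy z hz hyz => ?_⟩, rfl⟩
  · have := hx (Set.add_mem_add hy hb) (Set.add_mem_add hz hb) (by
      obtain ⟨s, t, hs, ht, hst, rfl⟩ := hyz
      refine ⟨s, t, hs, ht, hst, ?_⟩
      obtain rfl : t = 1 - s := by linarith
      module)
    exact add_right_cancel this
  · have := hx (Set.add_mem_add ha hy) (Set.add_mem_add ha hz) (by
      obtain ⟨s, t, hs, ht, hst, rfl⟩ := hyz
      refine ⟨s, t, hs, ht, hst, ?_⟩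
      obtain rfl : t = 1 - s := by linarith
      module)
    exact add_left_cancel this

section Reflection

variable {V : Type*} [NormedAddCommGroup V] [InnerProductSpace ℝ V]

/-- The pairing `x ↦ ⟨x, α^∨⟩`. -/
noncomputable def corootPairing (α : V) : V →ₗ[ℝ] ℝ := (2 / ⟪α, α⟫) • innerₗ V α

theorem corootPairing_apply (α x : V) : corootPairing α x = 2 * ⟪x, α⟫ / ⟪α, α⟫ := by
  simp only [corootPairing, LinearMap.smul_apply, innerₗ_apply_apply, smul_eq_mul,
    real_inner_comm α x]
  ring

theorem reflVec_eq (α x : V) : reflVec α x = x - corootPairing α x • α := by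
  rw [reflVec, corootPairing_apply]

theorem inner_eq_corootPairing {α : V} (hα : α ≠ 0) (x : V) :
    ⟪x, α⟫ = corootPairing α x * ⟪α, α⟫ / 2 := by
  have : ⟪α, α⟫ ≠ 0 := inner_self_ne_zero.2 hα
  rw [corootPairing_apply]
  field_simp

theorem corootPairing_self {α : V} (hα : α ≠ 0) : corootPairing α α = 2 := by
  have : ⟪α, α⟫ ≠ 0 := inner_self_ne_zero.2 hα
  rw [corootPairing_apply]
  field_simp

theorem reflVec_add (α x y : V) : reflVec α (x + y) = reflVec α x + reflVec α y := by
  simp only [reflVec_eq, map_add]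
  module

theorem reflVec_reflVec {α : V} (hα : α ≠ 0) (x : V) : reflVec α (reflVec α x) = x := by
  simp only [reflVec_eq, map_sub, map_smul, corootPairing_self hα, smul_eq_mul]
  module

theorem inner_reflVec (α x y : V) : ⟪x, reflVec α y⟫ = ⟪reflVec α x, y⟫ := by
  simp only [reflVec, inner_sub_left, inner_sub_right, real_inner_smul_left, real_inner_smul_right,
    real_inner_comm α y]
  ring

theorem norm_reflVec {α : V} (hα : α ≠ 0) (x : V) : ‖reflVec α x‖ = ‖x‖ := by
  rw [norm_eq_sqrt_real_inner, inner_reflVec, reflVec_reflVec hα, ← norm_eq_sqrt_real_inner]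

end Reflection

namespace RootSystemWithBase

variable {V : Type*} [NormedAddCommGroup V] [InnerProductSpace ℝ V] [FiniteDimensional ℝ V]
variable {l : ℕ} (R : RootSystemWithBase V l)

theorem simple_ne_zero (i : Fin l) : R.simple i ≠ 0 := R.nz _ (R.simpleMem i)

theorem top_le_span_simple : ⊤ ≤ Submodule.span ℝ (Set.range R.simple) := by
  rw [← R.spans, Submodule.span_le]
  intro β hβ
  rcases R.base β hβ with ⟨c, -, rfl⟩ | ⟨c, -, rfl⟩ <;>
    exact Submodule.sum_mem _ fun i _ => Submodule.smul_mem _ _ (Submodule.subset_span ⟨i, rfl⟩)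

/-- The simple roots as a basis of `V`. -/
noncomputable def simpleBasis : Module.Basis (Fin l) ℝ V :=
  Module.Basis.mk R.indep R.top_le_span_simple

theorem simpleBasis_apply (i : Fin l) : R.simpleBasis i = R.simple i := by
  simp [simpleBasis]

/-- The linear functional taking the value `1` on every simple root. -/
noncomputable def height : V →ₗ[ℝ] ℝ := R.simpleBasis.constr ℝ fun _ => (1 : ℝ)

theorem height_simple (i : Fin l) : R.height (R.simple i) = 1 := by
  rw [← R.simpleBasis_apply, height, Module.Basis.constr_basis]

theorem corootPairing_simple_nonpos {i j : Fin l} (hij : j ≠ i) :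
    corootPairing (R.simple i) (R.simple j) ≤ 0 := by
  have hmem := R.reflMem _ (R.simpleMem i) _ (R.simpleMem j)
  rw [reflVec_eq] at hmem
  set n := corootPairing (R.simple i) (R.simple j)
  have hcoord : ∀ c : Fin l → ℝ, R.simple j - n • R.simple i = ∑ k, c k • R.simple k →
      c j = 1 ∧ c i = -n := by
    intro c hc
    have h1 : R.simpleBasis.repr (R.simple j - n • R.simple i) = Finsupp.single j 1
        - n • Finsupp.single i 1 := by
      simp only [← R.simpleBasis_apply, map_sub, map_smul, Module.Basis.repr_self]
    rw [hc] at h1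
    simp only [← R.simpleBasis_apply] at h1
    have h2 : ∀ k, R.simpleBasis.repr (∑ k, c k • R.simpleBasis k) k = c k := fun k => by
      rw [Module.Basis.repr_sum_self]
    constructor
    · rw [← h2 j, h1]; simp [hij.symm]
    · rw [← h2 i, h1]; simp [hij]
  rcases R.base _ hmem with ⟨c, hc, h⟩ | ⟨c, hc, h⟩
  · have := hcoord c h
    linarith [hc i]
  · have := hcoord c h
    linarith [hc j]

theorem isClosed_negCone :
    IsClosed {x | ∃ c : Fin l → ℝ, (∀ i, 0 ≤ c i) ∧ x = -∑ i, c i • R.simple i} := by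
  have : {x | ∃ c : Fin l → ℝ, (∀ i, 0 ≤ c i) ∧ x = -∑ i, c i • R.simple i} =
      ⋂ i, {x | R.simpleBasis.coord i x ≤ 0} := by
    ext x
    simp only [Set.mem_ofPred_eq, Set.mem_iInter]
    constructor
    · rintro ⟨c, hc, rfl⟩ i
      simp only [← R.simpleBasis_apply, map_neg, Module.Basis.coord_apply,
        Module.Basis.repr_sum_self]
      linarith [hc i]
    · intro h
      refine ⟨fun i => -R.simpleBasis.coord i x, fun i => by linarith [h i], ?_⟩
      simp only [← R.simpleBasis_apply, neg_smul, Finset.sum_neg_distrib, neg_neg,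
        Module.Basis.coord_apply, Module.Basis.sum_repr]
  rw [this]
  exact isClosed_iInter fun i => isClosed_le
    (R.simpleBasis.coord i).continuous_of_finiteDimensional continuous_const

theorem convex_negCone :
    Convex ℝ {x | ∃ c : Fin l → ℝ, (∀ i, 0 ≤ c i) ∧ x = -∑ i, c i • R.simple i} := by
  rintro _ ⟨c, hc, rfl⟩ _ ⟨d, hd, rfl⟩ a b ha hb -
  refine ⟨fun i => a * c i + b * d i, fun i => by have := hc i; have := hd i; positivity, ?_⟩
  simp only [add_smul, mul_smul, Finset.sum_add_distrib, Finset.smul_sum, smul_neg]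
  abel

theorem mem_Q_iff {P : Set V} (hP : IsCompact P) (hc : Convex ℝ P) {m : V} :
    m ∈ R.Q P ↔ ∃ p ∈ P, ∃ c : Fin l → ℝ, (∀ i, 0 ≤ c i) ∧ m = p - ∑ i, c i • R.simple i := by
  constructor
  · intro hm
    set C := {x | ∃ c : Fin l → ℝ, (∀ i, 0 ≤ c i) ∧ x = -∑ i, c i • R.simple i}
    by_contra hcon
    have hnot : m ∉ P + C := by
      rintro ⟨p, hp, _, ⟨c, hc, rfl⟩, rfl⟩
      exact hcon ⟨p, hp, c, hc, (sub_eq_add_neg _ _).symm⟩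
    obtain ⟨f, s, hfm, hfs⟩ := geometric_hahn_banach_point_closed (hc.add R.convex_negCone)
      (R.isClosed_negCone.add_left_of_isCompact hP) hnot
    set u := (InnerProductSpace.toDual ℝ V).symm f
    have hu : ∀ x, f x = ⟪x, u⟫ := fun x => by
      rw [real_inner_comm, InnerProductSpace.toDual_symm_apply]
    have h0 : (0 : V) ∈ C := ⟨0, fun _ => le_rfl, by simp⟩
    have hP0 : ∀ p ∈ P, s < f p := fun p hp => by
      simpa using hfs _ (Set.add_mem_add hp h0)
    by_cases hanti : ∀ i, ⟪R.simple i, u⟫ ≤ 0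
    · obtain ⟨p, hp, hpm⟩ := hm u hanti
      have := hP0 p hp
      rw [hu] at this hfm
      linarith
    · push Not at hanti
      obtain ⟨i, hi⟩ := hanti
      obtain ⟨p, hp, -⟩ := hm 0 (by simp)
      have hps := hP0 p hp
      set t := (f p - s) / ⟪R.simple i, u⟫ with ht
      have ht0 : 0 ≤ t := div_nonneg (by linarith) hi.le
      have := hfs (p + -(t • R.simple i)) (Set.add_mem_add hp
        ⟨Pi.single i t, fun j => by
          by_cases hj : j = i
          · subst hj; simpa using ht0
          · simp [hj], by
          rw [Finset.sum_eq_single i (fun j _ hj => by simp [hj]) (by simp)]; simp⟩)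
      rw [map_add, map_neg, map_smul, hu (R.simple i), smul_eq_mul, ht, div_mul_cancel₀ _ hi.ne']
        at this
      linarith
  · rintro ⟨p, hp, c, hc, rfl⟩ u hu
    refine ⟨p, hp, ?_⟩
    rw [inner_sub_left, sum_inner]
    have : ∑ i, ⟪c i • R.simple i, u⟫ ≤ 0 := Finset.sum_nonpos fun i _ => by
      rw [real_inner_smul_left]
      exact mul_nonpos_of_nonneg_of_nonpos (hc i) (hu i)
    linarith

theorem subset_Q (P : Set V) : P ⊆ R.Q P := fun m hm _ _ => ⟨m, hm, le_rfl⟩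

theorem Q_add_subset (P₁ P₂ : Set V) : R.Q P₁ + R.Q P₂ ⊆ R.Q (P₁ + P₂) := by
  rintro _ ⟨x, hx, y, hy, rfl⟩ u hu
  obtain ⟨p, hp, hpx⟩ := hx u hu
  obtain ⟨q, hq, hqy⟩ := hy u hu
  exact ⟨p + q, Set.add_mem_add hp hq, by simp only [inner_add_left]; linarith⟩

theorem sub_sum_mem_Q {P : Set V} {m : V} (hm : m ∈ R.Q P) {c : Fin l → ℝ} (hc : ∀ i, 0 ≤ c i) :
    m - ∑ i, c i • R.simple i ∈ R.Q P := by
  intro u hu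
  obtain ⟨p, hp, hpm⟩ := hm u hu
  refine ⟨p, hp, ?_⟩
  rw [inner_sub_left, sum_inner]
  have : ∑ i, ⟪c i • R.simple i, u⟫ ≤ 0 := Finset.sum_nonpos fun i _ => by
    rw [real_inner_smul_left]
    exact mul_nonpos_of_nonneg_of_nonpos (hc i) (hu i)
  linarith

theorem sub_simple_mem_Q {P : Set V} {m : V} (hm : m ∈ R.Q P) (i : Fin l) :
    m - R.simple i ∈ R.Q P := by
  intro u hu
  obtain ⟨p, hp, hpm⟩ := hm u hu
  exact ⟨p, hp, by rw [inner_sub_left]; linarith [hu i]⟩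

/-- A dominant element of `Q(P)` lies in `P`. -/
theorem mem_of_mem_Q_of_dominant {P : Set V} (hP : IsCompact P) (hc : Convex ℝ P)
    (hW : R.WInvariant P) {m : V} (hm : m ∈ R.Q P)
    (hdom : ∀ i, 0 ≤ corootPairing (R.simple i) m) : m ∈ P := by
  by_contra hnot
  obtain ⟨f, s, hfm, hfs⟩ := geometric_hahn_banach_point_closed hc hP.isClosed hnot
  set u := (InnerProductSpace.toDual ℝ V).symm f
  have hu : ∀ x, f x = ⟪x, u⟫ := fun x => by
    rw [real_inner_comm, InnerProductSpace.toDual_symm_apply]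
  set K : Set V := {w | ‖w‖ ≤ ‖u‖ ∧ (∀ p ∈ P, s ≤ ⟪p, w⟫) ∧ ⟪m, w⟫ ≤ f m}
  have hKc : IsCompact K := by
    refine (isCompact_closedBall (0 : V) ‖u‖).of_isClosed_subset ?_ fun w hw => by
      simpa using hw.1
    refine (isClosed_le continuous_norm continuous_const).inter (IsClosed.inter ?_ ?_)
    · change IsClosed {w | ∀ p ∈ P, s ≤ ⟪p, w⟫}
      simp only [Set.ofPred_forall]
      exact isClosed_iInter fun p => isClosed_iInter fun _ =>
        isClosed_le continuous_const (continuous_const.inner continuous_id)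
    · change IsClosed {w | ⟪m, w⟫ ≤ f m}
      exact isClosed_le (continuous_const.inner continuous_id) continuous_const
  have hne : K.Nonempty := ⟨u, le_rfl, fun p hp => by rw [← hu]; exact (hfs p hp).le, (hu m).ge⟩
  obtain ⟨w, ⟨hw1, hw2, hw3⟩, hmin⟩ := hKc.exists_isMinOn hne
    R.height.continuous_of_finiteDimensional.continuousOn
  have hanti : ∀ i, ⟪R.simple i, w⟫ ≤ 0 := by
    intro i
    by_contra! hi
    have hα := real_inner_self_pos.2 (R.simple_ne_zero i)
    have hpair : 0 < corootPairing (R.simple i) w := by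
      rw [corootPairing_apply, real_inner_comm]; positivity
    have hrefl : reflVec (R.simple i) w ∈ K := by
      refine ⟨by rwa [norm_reflVec (R.simple_ne_zero i)], fun p hp => ?_, ?_⟩
      · rw [inner_reflVec]
        exact hw2 _ (hW _ (R.simpleMem i) _ hp)
      · rw [reflVec_eq, inner_sub_right, real_inner_smul_right,
          inner_eq_corootPairing (R.simple_ne_zero i) m]
        have := hdom i
        have : 0 ≤ corootPairing (R.simple i) w *
          (corootPairing (R.simple i) m * ⟪R.simple i, R.simple i⟫ / 2) := by positivity
        linarith
    have := hmin hrefl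
    simp only [Set.mem_ofPred_eq, reflVec_eq, map_sub, map_smul, R.height_simple, smul_eq_mul] at this
    linarith
  obtain ⟨p, hp, hpm⟩ := hm w hanti
  linarith [hw2 p hp]

theorem exists_int_corootPairing {v x α : V} (hv : v ∈ R.weightLattice)
    (hx : x - v ∈ R.rootLattice) (hα : α ∈ R.Φ) : ∃ n : ℤ, corootPairing α x = n := by
  have hM : ∀ y ∈ R.rootLattice, ∃ n : ℤ, corootPairing α y = n := by
    intro y hy
    induction hy using Submodule.span_induction with
    | mem β hβ =>
      obtain ⟨n, hn⟩ := R.cryst α hα β hβ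
      exact ⟨n, by rw [corootPairing_apply, hn]⟩
    | zero => exact ⟨0, by simp⟩
    | add y z _ _ hy hz =>
      obtain ⟨n, hn⟩ := hy
      obtain ⟨k, hk⟩ := hz
      exact ⟨n + k, by rw [map_add, hn, hk]; push_cast; rfl⟩
    | smul a y _ hy =>
      obtain ⟨n, hn⟩ := hy
      exact ⟨a * n, by rw [map_zsmul, hn]; simp⟩
  obtain ⟨n, hn⟩ := hM _ hx
  obtain ⟨k, hk⟩ := hv α hα
  refine ⟨n + k, ?_⟩
  rw [← sub_add_cancel x v, map_add, hn, corootPairing_apply, ← hk]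
  push_cast
  rfl

theorem corootPairing_le_neg_one {v x : V} (hv : v ∈ R.weightLattice)
    (hx : x - v ∈ R.rootLattice) {i : Fin l} (h : corootPairing (R.simple i) x < 0) :
    corootPairing (R.simple i) x ≤ -1 := by
  obtain ⟨n, hn⟩ := R.exists_int_corootPairing hv hx (R.simpleMem i)
  rw [hn] at h ⊢
  have : n < 0 := by exact_mod_cast h
  exact_mod_cast (by omega : n ≤ -1)

theorem simple_mem_rootLattice (i : Fin l) : R.simple i ∈ R.rootLattice :=
  Submodule.subset_span (R.simpleMem i)

theorem reflVec_sub_mem_rootLattice {v x α : V} (hv : v ∈ R.weightLattice)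
    (hx : x - v ∈ R.rootLattice) (hα : α ∈ R.Φ) : reflVec α x - v ∈ R.rootLattice := by
  obtain ⟨n, hn⟩ := R.exists_int_corootPairing hv hx hα
  have : reflVec α x - v = (x - v) - n • α := by
    rw [reflVec_eq, hn, Int.cast_smul_eq_zsmul]; abel
  rw [this]
  exact Submodule.sub_mem _ hx (Submodule.smul_mem _ _ (Submodule.subset_span hα))

theorem add_mem_weightLattice {v w : V} (hv : v ∈ R.weightLattice) (hw : w ∈ R.weightLattice) :
    v + w ∈ R.weightLattice := by
  intro α hα
  obtain ⟨n, hn⟩ := hv α hα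
  obtain ⟨k, hk⟩ := hw α hα
  refine ⟨n + k, ?_⟩
  push_cast
  rw [hn, hk, inner_add_left]
  ring

variable {R}

namespace IsAdmissible

variable {P : Set V}

theorem isCompact (h : R.IsAdmissible P) : IsCompact P := by
  obtain ⟨⟨S, hS, -, rfl⟩, -⟩ := h
  exact hS.isCompact_convexHull (𝕜 := ℝ)

theorem convex (h : R.IsAdmissible P) : Convex ℝ P := by
  obtain ⟨⟨S, -, -, rfl⟩, -⟩ := h
  exact convex_convexHull ℝ S

theorem convexHull_extremePoints (h : R.IsAdmissible P) :
    convexHull ℝ (P.extremePoints ℝ) = P := by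
  have hfin : (P.extremePoints ℝ).Finite := by
    obtain ⟨⟨S, hS, -, rfl⟩, -⟩ := h
    exact hS.subset extremePoints_convexHull_subset
  conv_rhs => rw [← closure_convexHull_extremePoints h.isCompact h.convex]
  exact (hfin.isClosed_convexHull (𝕜 := ℝ)).closure_eq.symm

theorem add {P₁ P₂ : Set V} (h1 : R.IsAdmissible P₁) (h2 : R.IsAdmissible P₂)
    (hsum : ∀ j : Fin l, ∀ x ∈ (P₁ + P₂).extremePoints ℝ, x ∉ R.wall j) :
    R.IsAdmissible (P₁ + P₂) := by
  refine ⟨?_, ?_, ?_, hsum⟩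
  · obtain ⟨⟨S, hS, hS', rfl⟩, -⟩ := h1
    obtain ⟨⟨T, hT, hT', rfl⟩, -⟩ := h2
    exact ⟨S + T, hS.add hT, hS'.add hT', (convexHull_add S T).symm⟩
  · rintro α hα _ ⟨x, hx, y, hy, rfl⟩
    rw [reflVec_add]
    exact Set.add_mem_add (h1.2.1 α hα x hx) (h2.2.1 α hα y hy)
  · intro v hv
    obtain ⟨x, hx, y, hy, rfl⟩ := extremePoints_add_subset _ _ hv
    exact R.add_mem_weightLattice (h1.2.2.1 x hx) (h2.2.2.1 y hy)

/-- Every point of an admissible polytope can be moved within it along the simple root `α_i` to a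
point pairing with `α_i^∨` to at least `1`. -/
theorem exists_add_smul_mem (h : R.IsAdmissible P) (i : Fin l) {p : V} (hp : p ∈ P) :
    ∃ t : ℝ, 0 ≤ t ∧ p + t • R.simple i ∈ P ∧
      1 ≤ corootPairing (R.simple i) (p + t • R.simple i) := by
  have hconv : Convex ℝ {p : V | ∃ t : ℝ, 0 ≤ t ∧ p + t • R.simple i ∈ P ∧
      1 ≤ corootPairing (R.simple i) (p + t • R.simple i)} := by
    rintro x ⟨t, ht, htP, ht1⟩ y ⟨s, hs, hsP, hs1⟩ a b ha hb hab
    have heq : a • x + b • y + (a * t + b * s) • R.simple i =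
        a • (x + t • R.simple i) + b • (y + s • R.simple i) := by module
    refine ⟨a * t + b * s, by positivity, ?_, ?_⟩
    · rw [heq]
      exact h.convex htP hsP ha hb hab
    · rw [heq, map_add, map_smul, map_smul, smul_eq_mul, smul_eq_mul]
      nlinarith
  rw [← h.convexHull_extremePoints] at hp
  refine convexHull_min (fun q hq => ?_) hconv hp
  obtain ⟨n, hn⟩ := h.2.2.1 q hq _ (R.simpleMem i)
  rw [← corootPairing_apply] at hn
  have hqP : q ∈ P := extremePoints_subset hq
  have hn0 : n ≠ 0 := by
    rintro rfl
    refine h.2.2.2 i q hq ?_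
    rw [wall, Set.mem_ofPred_eq, inner_eq_corootPairing (R.simple_ne_zero i), ← hn]
    simp
  rcases lt_or_gt_of_ne hn0 with hneg | hpos
  · have hneg' : (n : ℝ) ≤ -1 := by exact_mod_cast (by omega : n ≤ -1)
    refine ⟨-n, by linarith, ?_, ?_⟩
    · have := h.2.1 _ (R.simpleMem i) q hqP
      rwa [reflVec_eq, ← hn, sub_eq_add_neg, ← neg_smul] at this
    · rw [map_add, map_smul, corootPairing_self (R.simple_ne_zero i), ← hn, smul_eq_mul]
      linarith
  · refine ⟨0, le_rfl, by simpa using hqP, ?_⟩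
    rw [zero_smul, add_zero, ← hn]
    exact_mod_cast hpos

theorem mem_Q_iff (h : R.IsAdmissible P) {m : V} :
    m ∈ R.Q P ↔ ∃ p ∈ P, ∃ c : Fin l → ℝ, (∀ i, 0 ≤ c i) ∧ m = p - ∑ i, c i • R.simple i :=
  R.mem_Q_iff h.isCompact h.convex

theorem add_simple_mem_Q (h : R.IsAdmissible P) {m : V} (hm : m ∈ R.Q P) {i : Fin l}
    (hi : corootPairing (R.simple i) m ≤ -1) : m + R.simple i ∈ R.Q P := by
  obtain ⟨p, hp, c, hc, rfl⟩ := h.mem_Q_iff.1 hm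
  obtain ⟨t, ht, htP, ht1⟩ := h.exists_add_smul_mem i hp
  have hsum : ∑ j, c j • corootPairing (R.simple i) (R.simple j) ≤ 2 * c i := by
    rw [← Finset.add_sum_erase _ _ (Finset.mem_univ i), corootPairing_self (R.simple_ne_zero i)]
    have : ∑ j ∈ Finset.univ.erase i, c j • corootPairing (R.simple i) (R.simple j) ≤ 0 :=
      Finset.sum_nonpos fun j hj => mul_nonpos_of_nonneg_of_nonpos (hc j)
        (R.corootPairing_simple_nonpos (Finset.ne_of_mem_erase hj))
    rw [smul_eq_mul]
    linarith
  rw [map_sub, map_sum] at hi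
  simp only [map_smul] at hi
  rw [map_add, map_smul, corootPairing_self (R.simple_ne_zero i), smul_eq_mul] at ht1
  refine h.mem_Q_iff.2 ⟨_, htP, fun j => c j + (Pi.single i (t - 1) : Fin l → ℝ) j, fun j => ?_, ?_⟩
  · by_cases hj : j = i
    · subst hj
      simp only [Pi.single_eq_same]
      linarith
    · simpa [hj] using hc j
  · simp only [add_smul, Finset.sum_add_distrib]
    have : ∑ j, (Pi.single i (t - 1) : Fin l → ℝ) j • R.simple j = (t - 1) • R.simple i := by
      rw [Finset.sum_eq_single i (fun j _ hj => by simp [hj]) (by simp)]; simp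
    rw [this]
    module

theorem exists_height_le (h : R.IsAdmissible P) : ∃ B : ℝ, ∀ m ∈ R.Q P, R.height m ≤ B := by
  obtain ⟨B, hB⟩ := h.isCompact.bddAbove_image
    R.height.continuous_of_finiteDimensional.continuousOn
  refine ⟨B, fun m hm => ?_⟩
  obtain ⟨p, hp, c, hc, rfl⟩ := h.mem_Q_iff.1 hm
  have h1 : R.height p ≤ B := hB ⟨p, hp, rfl⟩
  have h2 : 0 ≤ ∑ i, c i := Finset.sum_nonneg fun i _ => hc i
  simp only [map_sub, map_sum, map_smul, R.height_simple, smul_eq_mul, mul_one]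
  linarith

theorem mem_of_dominant (h : R.IsAdmissible P) {m : V} (hm : m ∈ R.Q P)
    (hdom : ∀ i, 0 ≤ corootPairing (R.simple i) m) : m ∈ P :=
  R.mem_of_mem_Q_of_dominant h.isCompact h.convex h.2.1 hm hdom

/-- Every lattice point of `Q(P)` lies below a lattice point of `P`. -/
theorem exists_mem_sub_sum (h : R.IsAdmissible P) {v m : V} (hv : v ∈ R.weightLattice)
    (hm : m ∈ R.Q P) (hmv : m - v ∈ R.rootLattice) :
    ∃ p ∈ P, p - v ∈ R.rootLattice ∧
      ∃ c : Fin l → ℝ, (∀ i, 0 ≤ c i) ∧ m = p - ∑ i, c i • R.simple i := by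
  obtain ⟨B, hB⟩ := h.exists_height_le
  induction m using gap_induction (fun m => B - R.height m) one_pos with
  | _ m ih =>
  by_cases hdom : ∀ i, 0 ≤ corootPairing (R.simple i) m
  · exact ⟨m, h.mem_of_dominant hm hdom, hmv, 0, fun _ => le_rfl, by simp⟩
  · push Not at hdom
    obtain ⟨i, hi⟩ := hdom
    have hQ := h.add_simple_mem_Q hm (R.corootPairing_le_neg_one hv hmv hi)
    obtain ⟨p, hp, hpv, c, hc, hpc⟩ := ih (m + R.simple i) (sub_nonneg.2 (hB _ hQ))
      (by rw [map_add, R.height_simple]; linarith) hQ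
      (by rw [add_sub_right_comm]; exact Submodule.add_mem _ hmv (R.simple_mem_rootLattice i))
    refine ⟨p, hp, hpv, fun j => c j + (Pi.single i 1 : Fin l → ℝ) j, fun j => ?_, ?_⟩
    · have : (0 : ℝ) ≤ (Pi.single i 1 : Fin l → ℝ) j := by
        by_cases hj : j = i
        · subst hj; simp
        · simp [hj]
      linarith [hc j]
    · simp only [add_smul, Finset.sum_add_distrib]
      have : ∑ j, (Pi.single i 1 : Fin l → ℝ) j • R.simple j = R.simple i := by
        rw [Finset.sum_eq_single i (fun j _ hj => by simp [hj]) (by simp)]; simp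
      rw [this, ← sub_sub, ← hpc, add_sub_cancel_right]

/-- Lattice decompositions `m = x + (m - x)` with `x ∈ Q(P₁)`, `m - x ∈ Q(P₂)` of a dominant
`m` whose sum of squared norms is minimal up to a gap `c` satisfy `x ∈ P₁`. -/
theorem mem_of_norm_minimal {P₁ P₂ : Set V} (h1 : R.IsAdmissible P₁) {v₁ v₂ m : V} {c : ℝ}
    (hc : ∀ i, c ≤ ‖R.simple i‖ ^ 2) (hv₁ : v₁ ∈ R.weightLattice) (hv₂ : v₂ ∈ R.weightLattice)
    (hdom : ∀ i, 0 ≤ corootPairing (R.simple i) m) {x : V}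
    (hx : x ∈ R.Q P₁) (hxv : x - v₁ ∈ R.rootLattice)
    (hy : m - x ∈ R.Q P₂) (hyv : m - x - v₂ ∈ R.rootLattice)
    (hmin : ∀ z ∈ R.Q P₁, z - v₁ ∈ R.rootLattice → m - z ∈ R.Q P₂ →
      m - z - v₂ ∈ R.rootLattice → ‖x‖ ^ 2 + ‖m - x‖ ^ 2 - c < ‖z‖ ^ 2 + ‖m - z‖ ^ 2) :
    x ∈ P₁ := by
  obtain ⟨B, hB⟩ := h1.exists_height_le
  induction x using gap_induction (fun m => B - R.height m) one_pos with
  | _ x ih =>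
  by_cases hdomx : ∀ i, 0 ≤ corootPairing (R.simple i) x
  · exact h1.mem_of_dominant hx hdomx
  push Not at hdomx
  obtain ⟨i, hi⟩ := hdomx
  obtain ⟨a, ha⟩ := R.exists_int_corootPairing hv₁ hxv (R.simpleMem i)
  obtain ⟨b, hb⟩ := R.exists_int_corootPairing hv₂ hyv (R.simpleMem i)
  have hdomi := hdom i
  have hsum : corootPairing (R.simple i) m = a + b := by
    rw [← ha, ← hb, ← map_add, add_sub_cancel]
  have ha1 : a ≤ -1 := by
    rw [ha] at hi
    have : a < 0 := by exact_mod_cast hi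
    omega
  have hb1 : 0 ≤ a + b := by
    rw [hsum] at hdomi
    exact_mod_cast hdomi
  have hα := real_inner_self_eq_norm_sq (R.simple i)
  have hNx : ‖x + R.simple i‖ ^ 2 = ‖x‖ ^ 2 + ‖R.simple i‖ ^ 2 * (a + 1) := by
    rw [norm_add_sq_real, inner_eq_corootPairing (R.simple_ne_zero i), ha, hα]
    ring
  have hsub : m - (x + R.simple i) = m - x - R.simple i := by abel
  have hNy : ‖m - (x + R.simple i)‖ ^ 2 = ‖m - x‖ ^ 2 + ‖R.simple i‖ ^ 2 * (1 - b) := by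
    rw [hsub, norm_sub_sq_real, inner_eq_corootPairing (R.simple_ne_zero i), hb, hα]
    ring
  have hx' := h1.add_simple_mem_Q hx (i := i) (by rw [ha]; exact_mod_cast ha1)
  have hxv' : x + R.simple i - v₁ ∈ R.rootLattice := by
    rw [add_sub_right_comm]
    exact Submodule.add_mem _ hxv (R.simple_mem_rootLattice i)
  have hy' : m - (x + R.simple i) ∈ R.Q P₂ := by
    rw [hsub]
    exact R.sub_simple_mem_Q hy i
  have hyv' : m - (x + R.simple i) - v₂ ∈ R.rootLattice := by
    rw [hsub, sub_right_comm]
    exact Submodule.sub_mem _ hyv (R.simple_mem_rootLattice i)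
  have hN : ‖x + R.simple i‖ ^ 2 + ‖m - (x + R.simple i)‖ ^ 2 =
      ‖x‖ ^ 2 + ‖m - x‖ ^ 2 + ‖R.simple i‖ ^ 2 * (a - b + 2 : ℤ) := by
    rw [hNx, hNy]
    push_cast
    ring
  have hab : a - b + 2 = 0 := by
    by_contra hne
    have h3 : ((a - b + 2 : ℤ) : ℝ) ≤ -1 := by exact_mod_cast (by omega : a - b + 2 ≤ -1)
    have h4 := hmin _ hx' hxv' hy' hyv'
    rw [hN] at h4
    nlinarith [hc i, sq_nonneg ‖R.simple i‖]
  have hmem := ih (x + R.simple i) (sub_nonneg.2 (hB _ hx'))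
    (by rw [map_add, R.height_simple]; linarith) hx' hxv' hy' hyv' (by
      rw [hN, hab]
      simpa using hmin)
  have hrefl : reflVec (R.simple i) (x + R.simple i) = x := by
    obtain rfl : a = -1 := by omega
    rw [reflVec_eq, map_add, ha, corootPairing_self (R.simple_ne_zero i)]
    push_cast
    module
  rw [← hrefl]
  exact h1.2.1 _ (R.simpleMem i) _ hmem

/-- A lattice decomposition of a dominant element in `Q(P₁) + Q(P₂)` yields one in `P₁ + P₂`. -/
theorem exists_add_of_dominant {P₁ P₂ : Set V} (h1 : R.IsAdmissible P₁) (h2 : R.IsAdmissible P₂)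
    {v₁ v₂ m : V} (hv₁ : v₁ ∈ R.weightLattice) (hv₂ : v₂ ∈ R.weightLattice)
    (hdom : ∀ i, 0 ≤ corootPairing (R.simple i) m) {x : V}
    (hx : x ∈ R.Q P₁) (hxv : x - v₁ ∈ R.rootLattice)
    (hy : m - x ∈ R.Q P₂) (hyv : m - x - v₂ ∈ R.rootLattice) :
    m ∈ (P₁ ∩ {x | x - v₁ ∈ R.rootLattice}) + (P₂ ∩ {x | x - v₂ ∈ R.rootLattice}) := by
  obtain ⟨c, hc0, hc⟩ : ∃ c : ℝ, 0 < c ∧ ∀ i, c ≤ ‖R.simple i‖ ^ 2 := by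
    have hpos : ∀ i, 0 < ‖R.simple i‖ ^ 2 := fun i => by
      have := norm_pos_iff.2 (R.simple_ne_zero i)
      positivity
    rcases isEmpty_or_nonempty (Fin l) with hl | hl
    · exact ⟨1, one_pos, fun i => isEmptyElim i⟩
    · obtain ⟨i, hi⟩ := Finite.exists_min fun i => ‖R.simple i‖ ^ 2
      exact ⟨_, hpos i, hi⟩
  induction x using gap_induction (fun x => ‖x‖ ^ 2 + ‖m - x‖ ^ 2) hc0 with
  | _ x ih =>
  by_cases hmin : ∀ z ∈ R.Q P₁, z - v₁ ∈ R.rootLattice → m - z ∈ R.Q P₂ →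
      m - z - v₂ ∈ R.rootLattice → ‖x‖ ^ 2 + ‖m - x‖ ^ 2 - c < ‖z‖ ^ 2 + ‖m - z‖ ^ 2
  · have hxP := h1.mem_of_norm_minimal hc hv₁ hv₂ hdom hx hxv hy hyv hmin
    have hyP := h2.mem_of_norm_minimal hc hv₂ hv₁ hdom (x := m - x) hy hyv
      (by rwa [sub_sub_cancel]) (by rwa [sub_sub_cancel]) fun z hz hzv hz' hzv' => by
        have := hmin (m - z) hz' hzv' (by rwa [sub_sub_cancel]) (by rwa [sub_sub_cancel])
        rw [sub_sub_cancel] at this ⊢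
        linarith
    exact ⟨x, ⟨hxP, hxv⟩, m - x, ⟨hyP, hyv⟩, add_sub_cancel _ _⟩
  · push Not at hmin
    obtain ⟨z, hz, hzv, hz', hzv', hle⟩ := hmin
    exact ih z (by positivity) hle hz hzv hz' hzv'

end IsAdmissible

theorem lattice_add_subset (A B : Set V) (v₁ v₂ : V) :
    (A ∩ {x | x - v₁ ∈ R.rootLattice}) + (B ∩ {x | x - v₂ ∈ R.rootLattice}) ⊆
      (A + B) ∩ {x | x - (v₁ + v₂) ∈ R.rootLattice} := by
  rintro _ ⟨x, ⟨hx, hxv⟩, y, ⟨hy, hyv⟩, rfl⟩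
  refine ⟨Set.add_mem_add hx hy, ?_⟩
  rw [Set.mem_ofPred_eq, add_sub_add_comm]
  exact Submodule.add_mem _ hxv hyv

end RootSystemWithBase

/-- for admissible polytopes `P₁`, `P₂` with vertices in `v₁ + M`, `v₂ + M`
(`v₁, v₂ ∈ Λ`) such that no vertex of the Minkowski sum `P₁ + P₂` lies on a wall,
`(Q(P₁) ∩ (v₁+M)) + (Q(P₂) ∩ (v₂+M)) = Q(P₁+P₂) ∩ (v₁+v₂+M)` if and only if
`(P₁ ∩ (v₁+M)) + (P₂ ∩ (v₂+M)) = (P₁+P₂) ∩ (v₁+v₂+M)`. -/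
theorem stmt0 {V : Type*} [NormedAddCommGroup V] [InnerProductSpace ℝ V]
    [FiniteDimensional ℝ V] {l : ℕ} (R : RootSystemWithBase V l)
    (P₁ P₂ : Set V) (v₁ v₂ : V)
    (h1 : R.IsAdmissible P₁) (h2 : R.IsAdmissible P₂)
    (hv₁ : v₁ ∈ R.weightLattice) (hv₂ : v₂ ∈ R.weightLattice)
    (hP₁ : ∀ x ∈ P₁.extremePoints ℝ, x - v₁ ∈ R.rootLattice)
    (hP₂ : ∀ x ∈ P₂.extremePoints ℝ, x - v₂ ∈ R.rootLattice)
    (hsum : ∀ j : Fin l, ∀ x ∈ (P₁ + P₂).extremePoints ℝ, x ∉ R.wall j) :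
    ((R.Q P₁ ∩ {x | x - v₁ ∈ R.rootLattice}) + (R.Q P₂ ∩ {x | x - v₂ ∈ R.rootLattice}) =
        R.Q (P₁ + P₂) ∩ {x | x - (v₁ + v₂) ∈ R.rootLattice}) ↔
      ((P₁ ∩ {x | x - v₁ ∈ R.rootLattice}) + (P₂ ∩ {x | x - v₂ ∈ R.rootLattice}) =
        (P₁ + P₂) ∩ {x | x - (v₁ + v₂) ∈ R.rootLattice}) := by
  open RootSystemWithBase in
  have h12 := h1.add h2 hsum
  have hv := R.add_mem_weightLattice hv₁ hv₂
  constructor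
  · intro hQ
    refine (lattice_add_subset _ _ _ _).antisymm ?_
    rintro m ⟨hm, hmv⟩
    obtain ⟨B, hB⟩ := h12.exists_height_le
    induction m using gap_induction (fun m => B - R.height m) one_pos with
    | _ m ih =>
    by_cases hdom : ∀ i, 0 ≤ corootPairing (R.simple i) m
    · obtain ⟨x, ⟨hx, hxv⟩, y, ⟨hy, hyv⟩, rfl⟩ := hQ.ge ⟨R.subset_Q _ hm, hmv⟩
      exact h1.exists_add_of_dominant h2 hv₁ hv₂ hdom hx hxv
        (by simpa using hy) (by simpa using hyv)
    · push Not at hdom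
      obtain ⟨i, hi⟩ := hdom
      have hα := R.simpleMem i
      have hrP := h12.2.1 _ hα m hm
      obtain ⟨x, ⟨hx, hxv⟩, y, ⟨hy, hyv⟩, hxy⟩ := ih (reflVec (R.simple i) m)
        (sub_nonneg.2 (hB _ (R.subset_Q _ hrP))) (by
          have := R.corootPairing_le_neg_one hv hmv hi
          rw [reflVec_eq, map_sub, map_smul, R.height_simple, smul_eq_mul]
          linarith) hrP (R.reflVec_sub_mem_rootLattice hv hmv hα)
      refine ⟨reflVec (R.simple i) x, ⟨h1.2.1 _ hα x hx,
        R.reflVec_sub_mem_rootLattice hv₁ hxv hα⟩, reflVec (R.simple i) y, ⟨h2.2.1 _ hα y hy,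
        R.reflVec_sub_mem_rootLattice hv₂ hyv hα⟩, ?_⟩
      have hxy' : x + y = reflVec (R.simple i) m := hxy
      change reflVec (R.simple i) x + reflVec (R.simple i) y = m
      rw [← reflVec_add, hxy', reflVec_reflVec (R.simple_ne_zero i)]
  · intro hP
    refine ((lattice_add_subset _ _ _ _).trans
      (Set.inter_subset_inter_left _ (R.Q_add_subset P₁ P₂))).antisymm ?_
    rintro m ⟨hm, hmv⟩
    obtain ⟨p, hp, hpv, c, hc, rfl⟩ := h12.exists_mem_sub_sum hv hm hmv
    obtain ⟨x, ⟨hx, hxv⟩, y, ⟨hy, hyv⟩, rfl⟩ := hP.ge ⟨hp, hpv⟩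
    refine ⟨x, ⟨R.subset_Q _ hx, hxv⟩, y - ∑ i, c i • R.simple i,
      ⟨R.sub_sum_mem_Q (R.subset_Q _ hy) hc, ?_⟩, (add_sub_assoc _ _ _).symm⟩
    have hmv' : x + y - ∑ i, c i • R.simple i - (v₁ + v₂) ∈ R.rootLattice := hmv
    have hxv' : x - v₁ ∈ R.rootLattice := hxv
    change y - ∑ i, c i • R.simple i - v₂ ∈ R.rootLattice
    convert Submodule.sub_mem _ hmv' hxv' using 1
    abel
end

section
/- Let P be an admissible polytope. For each index j define R_j = {q + t(−α_j) : q ∈ Q(P) ∩ H_j, t ∈ ℝ, −1/2 ≤ t ≤ 1/2}. Then R_j ⊆ Q(P). -/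
open scoped RealInnerProductSpace Pointwise

/-- Distinct simple roots form a non-acute angle. -/
theorem RootSystemWithBase.inner_simple_nonpos {V : Type*} [NormedAddCommGroup V]
    [InnerProductSpace ℝ V] [FiniteDimensional ℝ V] {l : ℕ} (R : RootSystemWithBase V l)
    {i j : Fin l} (hij : i ≠ j) : ⟪R.simple i, R.simple j⟫ ≤ 0 := by
  set n := 2 * ⟪R.simple i, R.simple j⟫ / ⟪R.simple j, R.simple j⟫ with hn
  have hpos : 0 < ⟪R.simple j, R.simple j⟫ :=
    real_inner_self_pos.2 (R.nz _ (R.simpleMem j))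
  have hsum : reflVec (R.simple j) (R.simple i) =
      ∑ k, ((Pi.single i 1 : Fin l → ℝ) k - n * (Pi.single j 1 : Fin l → ℝ) k) • R.simple k := by
    simp [reflVec, sub_smul, Finset.sum_sub_distrib, Pi.single_apply, hn]
  have hcoord : ∀ c : Fin l → ℝ,
      reflVec (R.simple j) (R.simple i) = ∑ k, c k • R.simple k → c i = 1 ∧ c j = -n := by
    intro c hc
    have h := Fintype.linearIndependent_iff.1 R.indep
      (fun k => c k - ((Pi.single i 1 : Fin l → ℝ) k - n * (Pi.single j 1 : Fin l → ℝ) k))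
      (by simp only [sub_smul _ (_ - _), Finset.sum_sub_distrib, ← hc, ← hsum, sub_self])
    have hi := h i
    have hj := h j
    simp [hij, hij.symm] at hi hj
    constructor <;> linarith
  have hn0 : n ≤ 0 := by
    rcases R.base _ (R.reflMem _ (R.simpleMem j) _ (R.simpleMem i)) with ⟨c, hc, h⟩ | ⟨c, hc, h⟩
    · linarith [(hcoord c h).2, hc j]
    · linarith [(hcoord c h).1, hc i]
  rw [hn, div_le_iff₀ hpos] at hn0
  linarith

/-- A linear functional on a polytope takes a value at some vertex that is at most
its value at a given point. -/
theorem exists_extremePoint_inner_le {V : Type*} [NormedAddCommGroup V]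
    [InnerProductSpace ℝ V] {S : Set V} (hS : S.Finite) {p : V}
    (hp : p ∈ convexHull ℝ S) (u : V) :
    ∃ v ∈ (convexHull ℝ S).extremePoints ℝ, ⟪v, u⟫ ≤ ⟪p, u⟫ := by
  by_contra! h
  have hfin := hS.subset (extremePoints_convexHull_subset (𝕜 := ℝ) (A := S))
  have hKM := closure_convexHull_extremePoints (hS.isCompact_convexHull ℝ) (convex_convexHull ℝ S)
  rw [(hfin.isClosed_convexHull ℝ).closure_eq] at hKM
  have hconv : Convex ℝ {x : V | ⟪p, u⟫ < ⟪x, u⟫} :=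
    convex_halfSpace_gt ⟨fun x y => inner_add_left x y u, fun c x => by
      simp [real_inner_smul_left]⟩ _
  have hmem : p ∈ {x : V | ⟪p, u⟫ < ⟪x, u⟫} := convexHull_min h hconv (hKM.symm ▸ hp)
  exact lt_irrefl ⟪p, u⟫ hmem

/-- for an admissible polytope `P` and each index `j`, the set
`R_j = {q + t(−α_j) : q ∈ Q(P) ∩ H_j, −1/2 ≤ t ≤ 1/2}` is contained in `Q(P)`. -/
theorem stmt3 {V : Type*} [NormedAddCommGroup V] [InnerProductSpace ℝ V]
    [FiniteDimensional ℝ V] {l : ℕ} (R : RootSystemWithBase V l)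
    (P : Set V) (hP : R.IsAdmissible P) (j : Fin l) :
    {x : V | ∃ q ∈ R.Q P ∩ R.wall j, ∃ t : ℝ, -(1/2) ≤ t ∧ t ≤ 1/2 ∧
        x = q + t • (-(R.simple j))} ⊆ R.Q P := by
  rintro x ⟨q, ⟨hq, hqj⟩, t, ht, -, rfl⟩ u hu
  obtain ⟨⟨S, hS, -, rfl⟩, hW, hΛ, hwall⟩ := hP
  set a := R.simple j with ha
  have hqa : ⟪q, a⟫ = 0 := hqj
  have hpos : 0 < ⟪a, a⟫ := real_inner_self_pos.2 (R.nz _ (R.simpleMem j))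
  have hau : ⟪a, u⟫ ≤ 0 := hu j
  set c := ⟪a, u⟫ / ⟪a, a⟫ with hc
  have hc0 : c ≤ 0 := div_nonpos_of_nonpos_of_nonneg hau hpos.le
  have hca : c * ⟪a, a⟫ = ⟪a, u⟫ := div_mul_cancel₀ _ hpos.ne'
  have hproj : ∀ y : V, ⟪y, u - c • a⟫ = ⟪y, u⟫ - c * ⟪y, a⟫ := fun y => by
    rw [inner_sub_right, real_inner_smul_right]
  obtain ⟨p, hp, hpq⟩ := hq (u - c • a) fun i => by
    rw [hproj]
    rcases eq_or_ne i j with rfl | hij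
    · rw [← ha, hca, sub_self]
    · nlinarith [hu i, mul_nonneg_of_nonpos_of_nonpos hc0 (R.inner_simple_nonpos hij)]
  obtain ⟨v, hv, hvp⟩ := exists_extremePoint_inner_le hS hp (u - c • a)
  have hva : ⟪v, a⟫ ≠ 0 := hwall j v hv
  obtain ⟨n, hn⟩ := hΛ v hv a (R.simpleMem j)
  have hn' : (n : ℝ) * ⟪a, a⟫ = 2 * ⟪v, a⟫ := by rw [hn, div_mul_cancel₀ _ hpos.ne']
  have hn0 : n ≠ 0 := by
    rintro rfl
    exact hva (by simpa using hn'.symm)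
  obtain ⟨w, hw, hwv, hwa⟩ : ∃ w ∈ convexHull ℝ S,
      ⟪w, u - c • a⟫ = ⟪v, u - c • a⟫ ∧ ⟪a, a⟫ ≤ 2 * ⟪w, a⟫ := by
    rcases lt_or_gt_of_ne hn0 with h | h
    · refine ⟨reflVec a v, hW a (R.simpleMem j) v hv.1, ?_, ?_⟩
      · rw [reflVec, inner_sub_left, real_inner_smul_left, hproj a, hca, sub_self, mul_zero,
          sub_zero]
      · have h1 : (n : ℝ) ≤ -1 := by exact_mod_cast Int.le_sub_one_of_lt h
        rw [reflVec, inner_sub_left, real_inner_smul_left, ← hn]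
        nlinarith
    · have h1 : (1 : ℝ) ≤ n := by exact_mod_cast h
      exact ⟨v, hv.1, rfl, by nlinarith⟩
  refine ⟨w, hw, ?_⟩
  have hwq : ⟪w, u⟫ - c * ⟪w, a⟫ ≤ ⟪q, u⟫ := by
    have := hwv.le.trans (hvp.trans hpq)
    rwa [hproj w, hproj q, hqa, mul_zero, sub_zero] at this
  rw [inner_add_left, real_inner_smul_left, inner_neg_left]
  nlinarith [mul_nonneg_of_nonpos_of_nonpos hc0 (sub_nonpos.2 hwa),
    mul_nonneg (neg_nonneg.2 hau) (show 0 ≤ t + 1 / 2 by linarith)]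
end

section
/- Let P be an admissible polytope. Fix an index j and for each i ≠ j set f̃ᵢ = ½((−αᵢ) + s_j(−αᵢ)), the orthogonal projection of −αᵢ onto the wall H_j. Then Q(P) ∩ H_j = (P ∩ H_j ∩ C⁺) + {Σ_{i≠j} tᵢ f̃ᵢ : tᵢ ∈ ℝ, tᵢ ≥ 0}, where + denotes Minkowski sum of subsets of V. -/
open scoped RealInnerProductSpace Pointwise

namespace RootSystemWithBase

variable {V : Type*} [NormedAddCommGroup V] [InnerProductSpace ℝ V] [FiniteDimensional ℝ V]
variable {l : ℕ} (R : RootSystemWithBase V l)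

lemma inner_simple_self_pos (i : Fin l) : 0 < ⟪R.simple i, R.simple i⟫ :=
  real_inner_self_pos.2 (R.nz _ (R.simpleMem i))

/-- Distinct simple roots form a non-acute angle. -/
lemma inner_simple_nonpos_s4 {i j : Fin l} (hij : i ≠ j) : ⟪R.simple i, R.simple j⟫ ≤ 0 := by
  have hj := R.inner_simple_self_pos j
  set n : ℝ := 2 * ⟪R.simple i, R.simple j⟫ / ⟪R.simple j, R.simple j⟫ with hn
  have coeff : ∀ c : Fin l → ℝ, reflVec (R.simple j) (R.simple i) = ∑ k, c k • R.simple k →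
      c = Pi.single i 1 - Pi.single j n := by
    intro c hc
    have hinj := linearIndependent_iff_injective_fintypeLinearCombination.1 R.indep
    apply hinj
    rw [map_sub, Fintype.linearCombination_apply_single, Fintype.linearCombination_apply_single,
      Fintype.linearCombination_apply, ← hc, one_smul, reflVec]
  rcases R.base _ (R.reflMem _ (R.simpleMem j) _ (R.simpleMem i)) with ⟨c, hc, h⟩ | ⟨c, hc, h⟩
  · have h1 := hc j
    rw [coeff c h] at h1
    simp [hij.symm] at h1
    by_contra! hpos
    have : 0 < n := by positivity
    linarith
  · have h1 := hc i
    rw [coeff c h] at h1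
    simp [hij] at h1
    linarith

/-- The projection of `-αᵢ` onto the wall `H_j`, written out. -/
lemma half_smul_neg_add_reflVec (i j : Fin l) :
    (1 / 2 : ℝ) • (-(R.simple i) + reflVec (R.simple j) (-(R.simple i))) =
      -R.simple i +
        (⟪R.simple i, R.simple j⟫ / ⟪R.simple j, R.simple j⟫) • R.simple j := by
  rw [reflVec, inner_neg_left]
  module

/-- The displacement `p - x` from the point `x` of a reflection-invariant convex set nearest to a
dominant point `p` is dominant, and orthogonal to every simple root orthogonal to `p`. -/
lemma inner_sub_nearest {P : Set V} (hW : R.WInvariant P) {p x : V}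
    (hp : p ∈ R.domChamber) (hx : x ∈ P) (hnear : ∀ y ∈ P, ⟪p - x, y - x⟫ ≤ 0) (i : Fin l) :
    0 ≤ ⟪p - x, R.simple i⟫ ∧ (⟪p, R.simple i⟫ = 0 → ⟪p - x, R.simple i⟫ = 0) := by
  have hi := R.inner_simple_self_pos i
  have hpi := hp i
  have h := hnear _ (hW _ (R.simpleMem i) x hx)
  rw [reflVec, sub_sub_cancel_left, inner_neg_right, inner_smul_right, div_mul_eq_mul_div,
    neg_nonpos, le_div_iff₀ hi, zero_mul] at h
  rw [inner_sub_left] at *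
  generalize ⟪p, R.simple i⟫ = b at *
  generalize ⟪x, R.simple i⟫ = a at *
  refine ⟨by nlinarith, ?_⟩
  rintro rfl
  nlinarith

/-- Moreau decomposition with respect to the cone spanned by the `-αᵢ` with `i ≠ j` and by
`± α_j`. -/
lemma exists_moreau (j : Fin l) (m : V) :
    ∃ t : Fin l → ℝ, (∀ i, i ≠ j → 0 ≤ t i) ∧
      ⟪m + ∑ i, t i • R.simple i, R.simple j⟫ = 0 ∧
      ∀ i, i ≠ j → 0 ≤ ⟪m + ∑ i, t i • R.simple i, R.simple i⟫ ∧
        t i * ⟪m + ∑ i, t i • R.simple i, R.simple i⟫ = 0 := by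
  set T : (Fin l → ℝ) →ₗ[ℝ] V := -Fintype.linearCombination ℝ R.simple with hT
  have hTinj : Function.Injective T := fun a b hab =>
    linearIndependent_iff_injective_fintypeLinearCombination.1 R.indep (neg_injective hab)
  have hTs : ∀ i a, T (Pi.single i a) = -(a • R.simple i) := fun i a => by
    rw [hT, LinearMap.neg_apply, Fintype.linearCombination_apply_single]
  set S : Set (Fin l → ℝ) := {t | ∀ i, i ≠ j → 0 ≤ t i} with hS
  have hSclosed : IsClosed S := by
    simp only [hS, Set.ofPred_forall]
    exact isClosed_iInter fun i => isClosed_iInter fun _ =>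
      isClosed_le continuous_const (continuous_apply i)
  have hSconv : Convex ℝ S := fun a ha b hb r s hr hs _ i hi =>
    add_nonneg (mul_nonneg hr (ha i hi)) (mul_nonneg hs (hb i hi))
  have hcl : IsClosed (T '' S) :=
    (LinearMap.isClosedEmbedding_of_injective (LinearMap.ker_eq_bot.2 hTinj)).isClosedMap _ hSclosed
  have hconv : Convex ℝ (T '' S) := hSconv.linear_image T
  obtain ⟨_, ⟨t, ht, rfl⟩, hmin⟩ := exists_norm_eq_iInf_of_complete_convex
    (⟨T 0, 0, fun _ _ => le_rfl, rfl⟩ : (T '' S).Nonempty) hcl.isComplete hconv m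
  rw [norm_eq_iInf_iff_real_inner_le_zero hconv ⟨t, ht, rfl⟩] at hmin
  have hsum : m - T t = m + ∑ i, t i • R.simple i := by
    simp [hT, Fintype.linearCombination_apply]
  rw [hsum] at hmin
  set p := m + ∑ i, t i • R.simple i
  have key : ∀ i a, (i ≠ j → 0 ≤ t i + a) → 0 ≤ a * ⟪p, R.simple i⟫ := by
    intro i a ha
    have h := hmin (T (t + Pi.single i a)) ⟨_, ?_, rfl⟩
    · rw [map_add, add_sub_cancel_left, hTs, inner_neg_right, inner_smul_right] at h
      linarith
    · intro k hk
      rcases eq_or_ne k i with rfl | hki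
      · simpa using ha hk
      · simpa [hki] using ht k hk
  refine ⟨t, ht, ?_, fun i hi => ?_⟩
  · have h1 := key j 1 (fun h => absurd rfl h)
    have h2 := key j (-1) (fun h => absurd rfl h)
    linarith
  · have h1 := key i 1 (fun h => by linarith [ht i h])
    have h2 := key i (-t i) (fun h => by simp)
    rw [one_mul] at h1
    exact ⟨h1, le_antisymm (by linarith) (mul_nonneg (ht i hi) h1)⟩

end RootSystemWithBase

/-- for an admissible polytope `P` and an index `j`, setting
`f̃ᵢ = ½((−αᵢ) + s_j(−αᵢ))` for `i ≠ j`, we have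
`Q(P) ∩ H_j = (P ∩ H_j ∩ C⁺) + {Σ_{i≠j} tᵢ f̃ᵢ : tᵢ ≥ 0}`. -/
theorem stmt4 {V : Type*} [NormedAddCommGroup V] [InnerProductSpace ℝ V]
    [FiniteDimensional ℝ V] {l : ℕ} (R : RootSystemWithBase V l)
    (P : Set V) (hP : R.IsAdmissible P) (j : Fin l) :
    R.Q P ∩ R.wall j =
      (P ∩ R.wall j ∩ R.domChamber) +
        {x : V | ∃ t : Fin l → ℝ, (∀ i, 0 ≤ t i) ∧
          x = ∑ i ∈ Finset.univ.erase j, t i •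
            ((1 / 2 : ℝ) • (-(R.simple i) + reflVec (R.simple j) (-(R.simple i))))} := by
  obtain ⟨⟨S, hSfin, hSne, rfl⟩, hW, -, -⟩ := hP
  set P := convexHull ℝ S
  have hj := R.inner_simple_self_pos j
  simp only [R.half_smul_neg_add_reflVec]
  ext m
  rw [Set.mem_add]
  constructor
  · rintro ⟨hQ, hm⟩
    obtain ⟨t, ht, hpj, hp⟩ := R.exists_moreau j m
    set q := ∑ i, t i • R.simple i with hq
    have hdom : m + q ∈ R.domChamber := fun i => by
      rcases eq_or_ne i j with rfl | hi
      · exact hpj.ge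
      · exact (hp i hi).1
    obtain ⟨x, hxP, hmin⟩ := exists_norm_eq_iInf_of_complete_convex
      (hSne.convexHull (𝕜 := ℝ)) (hSfin.isCompact_convexHull ℝ).isComplete (convex_convexHull ℝ S)
      (m + q)
    rw [norm_eq_iInf_iff_real_inner_le_zero (convex_convexHull ℝ S) hxP] at hmin
    have hu := R.inner_sub_nearest hW hdom hxP hmin
    set u := m + q - x with hudef
    have huq : ⟪u, q⟫ = 0 := by
      rw [hq, inner_sum]
      refine Finset.sum_eq_zero fun i _ => ?_
      rw [inner_smul_right]
      rcases eq_or_ne i j with rfl | hi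
      · rw [(hu i).2 hpj, mul_zero]
      · rcases mul_eq_zero.1 (hp i hi).2 with h | h
        · rw [h, zero_mul]
        · rw [(hu i).2 h, mul_zero]
    have hmem : m + q ∈ P := by
      obtain ⟨y, hyP, hy⟩ := hQ (-u) fun i => by
        rw [inner_neg_right, real_inner_comm]
        linarith [(hu i).1]
      have h1 := hmin y hyP
      have h2 : ⟪u, u⟫ = ⟪u, m⟫ + ⟪u, q⟫ - ⟪u, x⟫ := by
        rw [← inner_add_right, ← inner_sub_right]
      rw [inner_neg_right, inner_neg_right, real_inner_comm, real_inner_comm u m] at hy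
      rw [inner_sub_right] at h1
      have h3 : u = 0 := real_inner_self_nonpos.1 (by linarith : ⟪u, u⟫ ≤ 0)
      rwa [sub_eq_zero.1 h3]
    refine ⟨m + q, ⟨⟨hmem, hpj⟩, hdom⟩, -q, ⟨fun i => if i = j then 0 else t i, ?_, ?_⟩,
      add_neg_cancel_right m q⟩
    · intro i
      dsimp only
      split_ifs with h
      exacts [le_rfl, ht i h]
    · have hqj : ⟪q, R.simple j⟫ = 0 := by
        have hm' : ⟪m, R.simple j⟫ = 0 := hm
        rwa [inner_add_left, hm', zero_add] at hpj
      rw [hq, sum_inner, ← Finset.add_sum_erase _ _ (Finset.mem_univ j)] at hqj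
      simp only [inner_smul_left, conj_trivial] at hqj
      have hcoef : ∑ i ∈ Finset.univ.erase j,
          t i * (⟪R.simple i, R.simple j⟫ / ⟪R.simple j, R.simple j⟫) = -t j := by
        simp only [← mul_div_assoc]
        rw [← Finset.sum_div, div_eq_iff hj.ne']
        linarith
      have hterm : ∀ i ∈ Finset.univ.erase j,
          (if i = j then 0 else t i) • (-R.simple i +
            (⟪R.simple i, R.simple j⟫ / ⟪R.simple j, R.simple j⟫) • R.simple j) =
          -(t i • R.simple i) +
            (t i * (⟪R.simple i, R.simple j⟫ / ⟪R.simple j, R.simple j⟫)) • R.simple j :=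
        fun i hi => by rw [if_neg (Finset.ne_of_mem_erase hi), smul_add, smul_neg, smul_smul]
      rw [Finset.sum_congr rfl hterm, Finset.sum_add_distrib, ← Finset.sum_smul, hcoef,
        Finset.sum_neg_distrib, hq, ← Finset.add_sum_erase _ _ (Finset.mem_univ j)]
      module
  · rintro ⟨p, ⟨⟨hpP, hpj⟩, -⟩, _, ⟨t, ht, rfl⟩, rfl⟩
    refine ⟨fun u hu => ⟨p, hpP, ?_⟩, ?_⟩
    · rw [inner_add_left, sum_inner]
      refine le_add_of_nonneg_right (Finset.sum_nonneg fun i hi => ?_)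
      rw [inner_smul_left, inner_add_left, inner_neg_left, inner_smul_left]
      refine mul_nonneg (ht i) (add_nonneg (neg_nonneg.2 (hu i)) (mul_nonneg_of_nonpos_of_nonpos
        (div_nonpos_of_nonpos_of_nonneg
          (R.inner_simple_nonpos_s4 (Finset.ne_of_mem_erase hi)) hj.le) (hu j)))
    · have hpj' : ⟪p, R.simple j⟫ = 0 := hpj
      change ⟪_, R.simple j⟫ = 0
      rw [inner_add_left, hpj', zero_add, sum_inner]
      refine Finset.sum_eq_zero fun i _ => ?_
      rw [inner_smul_left, inner_add_left, inner_neg_left, inner_smul_left, conj_trivial,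
        conj_trivial, div_mul_cancel₀ _ hj.ne', neg_add_cancel, mul_zero]
end

section
/- Let V be a finite-dimensional real inner product space, H ⊂ V a linear hyperplane, and s : V → V the orthogonal reflection across H. Let P ⊂ V be a polytope (the convex hull of a nonempty finite set) with s(P) = P and such that no vertex (extreme point) of P lies in H. Then every vertex of the polytope P ∩ H is of the form ½(p + s(p)) (the orthogonal projection of p onto H) for some vertex p of P. -/
open scoped RealInnerProductSpace

/-- A polytope is the convex hull of its extreme points. -/
theorem Set.Finite.convexHull_extremePoints_convexHull {E : Type*} [AddCommGroup E] [Module ℝ E]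
    [TopologicalSpace E] [T2Space E] [IsTopologicalAddGroup E] [ContinuousSMul ℝ E]
    [LocallyConvexSpace ℝ E] {S : Set E} (hS : S.Finite) :
    convexHull ℝ ((convexHull ℝ S).extremePoints ℝ) = convexHull ℝ S := by
  have hfin : ((convexHull ℝ S).extremePoints ℝ).Finite :=
    hS.subset extremePoints_convexHull_subset
  rw [← (hfin.isClosed_convexHull ℝ).closure_eq]
  exact closure_convexHull_extremePoints (hS.isCompact_convexHull ℝ) (convex_convexHull ℝ S)

/-- If a linear map `f` maps `A` into a convex set `Q`, then every extreme
point of `Q` that is fixed by `f` and lies in the convex hull of `A` is the image of a point of `A`. -/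
theorem exists_map_eq_of_mem_extremePoints {E : Type*} [AddCommGroup E] [Module ℝ E]
    {A Q : Set E} (hQ : Convex ℝ Q) (f : E →ₗ[ℝ] E) (hf : Set.MapsTo f A Q) {v : E}
    (hv : v ∈ Q.extremePoints ℝ) (hvA : v ∈ convexHull ℝ A) (hfv : f v = v) :
    ∃ a ∈ A, f a = v := by
  have hsub : convexHull ℝ (f '' A) ⊆ Q := convexHull_min hf.image_subset hQ
  have hmem : v ∈ convexHull ℝ (f '' A) := by
    rw [← f.image_convexHull]
    exact ⟨v, hvA, hfv⟩
  have hvf : v ∈ f '' A := extremePoints_convexHull_subset (𝕜 := ℝ)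
    (inter_extremePoints_subset_extremePoints_of_subset hsub ⟨hmem, hv⟩)
  exact hvf

/-- let `H` be a linear hyperplane of an inner product space `V` (the
orthogonal hyperplane to some nonzero `α`) and `s` the orthogonal reflection across `H`.
If `P` is a polytope with `s(P) = P` and no vertex of `P` lies in `H`, then every vertex
of `P ∩ H` is the orthogonal projection `½(p + s(p))` of some vertex `p` of `P`. -/
theorem stmt5 {V : Type*} [NormedAddCommGroup V] [InnerProductSpace ℝ V]
    (α : V) (hα : α ≠ 0)
    (H : Set V) (hH : H = {x : V | ⟪x, α⟫ = 0})
    (s : V → V) (hs : ∀ x, s x = x - (2 * ⟪x, α⟫ / ⟪α, α⟫) • α)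
    (P : Set V) (S : Set V) (hSfin : S.Finite) (hSne : S.Nonempty)
    (hPS : P = convexHull ℝ S)
    (hsym : s '' P = P)
    (hvert : ∀ p ∈ P.extremePoints ℝ, p ∉ H) :
    ∀ v ∈ (P ∩ H).extremePoints ℝ,
      ∃ p ∈ P.extremePoints ℝ, v = (1 / 2 : ℝ) • (p + s p) := by
  subst hH
  have hαα : ⟪α, α⟫ ≠ 0 := inner_self_ne_zero.mpr hα
  have hPconv : Convex ℝ P := hPS ▸ convex_convexHull ℝ S
  have hhull : convexHull ℝ (P.extremePoints ℝ) = P := by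
    rw [hPS]
    exact hSfin.convexHull_extremePoints_convexHull
  have hHconv : Convex ℝ {x : V | ⟪x, α⟫ = 0} := by
    intro x hx y hy a b _ _ _
    simp_all [inner_add_left, real_inner_smul_left]
  let f : V →ₗ[ℝ] V := LinearMap.id - ((⟪α, α⟫)⁻¹ • innerₗ V α).smulRight α
  have hf : ∀ x, f x = x - (⟪x, α⟫ / ⟪α, α⟫) • α := fun x ↦ by
    simp [f, real_inner_comm, div_eq_inv_mul]
  have hfs : ∀ x, f x = (1 / 2 : ℝ) • (x + s x) := fun x ↦ by
    rw [hf, hs]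
    module
  intro v hv
  have hvPH := extremePoints_subset hv
  have hmaps : Set.MapsTo f (P.extremePoints ℝ) (P ∩ {x : V | ⟪x, α⟫ = 0}) := by
    intro p hp
    have hpP := extremePoints_subset hp
    constructor
    · rw [hfs, smul_add]
      exact hPconv hpP (hsym ▸ Set.mem_image_of_mem s hpP) (by norm_num) (by norm_num)
        (by norm_num)
    · rw [Set.mem_ofPred_eq, hf, inner_sub_left, real_inner_smul_left, div_mul_cancel₀ _ hαα,
        sub_self]
  have hfv : f v = v := by
    have : ⟪v, α⟫ = 0 := hvPH.2
    simp [hf, this]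
  obtain ⟨p, hp, hpv⟩ := exists_map_eq_of_mem_extremePoints (hPconv.inter hHconv) f hmaps hv
    (hhull.symm ▸ hvPH.1) hfv
  exact ⟨p, hp, by rw [← hfs, hpv]⟩
end

section
/- Let K₁ and K₂ be convex hulls of nonempty finite subsets of ℤ² ⊂ ℝ², and set Q₁ = K₁ + [0,∞)² and Q₂ = K₂ + [0,∞)² (Minkowski sums). Suppose that for every u ∈ ℝ², the linear functional z ↦ ⟨u,z⟩ attains its minimum on Q₁ at a unique point if and only if it attains its minimum on Q₂ at a unique point. Then (Q₁ + Q₂) ∩ ℤ² = (Q₁ ∩ ℤ²) + (Q₂ ∩ ℤ²). -/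
open scoped Pointwise

/-- Moving nonnegative weights along a direction that vanishes off their support and has a
negative entry, one can stop at nonnegative weights of strictly smaller support. -/
theorem exists_nonneg_add_mul_eq_zero {ι : Type*} [Fintype ι] (w δ : ι → ℝ)
    (hw : ∀ i, 0 ≤ w i) (hδ : ∀ i, w i = 0 → δ i = 0) (hneg : ∃ i, δ i < 0) :
    ∃ t : ℝ, 0 ≤ t ∧ (∀ i, 0 ≤ w i + t * δ i) ∧ ∃ i, w i ≠ 0 ∧ w i + t * δ i = 0 := by
  classical
  obtain ⟨j, hj⟩ := hneg
  obtain ⟨i, hi, hmin⟩ := Finset.exists_min_image (Finset.univ.filter fun i => δ i < 0)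
    (fun i => w i / -δ i) ⟨j, by simpa using hj⟩
  simp only [Finset.mem_filter, Finset.mem_univ, true_and] at hi hmin
  have ht : 0 ≤ w i / -δ i := div_nonneg (hw i) (by linarith)
  refine ⟨w i / -δ i, ht, fun k => ?_, i, fun h => by linarith [hδ i h], ?_⟩
  · rcases lt_or_ge (δ k) 0 with hk | hk
    · have := hmin k hk
      rw [le_div_iff₀ (by linarith)] at this
      linarith
    · have := hw k
      positivity
  · have : δ i ≠ 0 := hi.ne
    field_simp
    ring

/-- At least `finrank E` vectors are either linearly dependent or span any given vector. -/
theorem exists_sum_smul_eq_zero_or_eq {ι E : Type*} [Fintype ι] [AddCommGroup E] [Module ℝ E]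
    [FiniteDimensional ℝ E] (g : ι → E) (s : Finset ι) (hs : Module.finrank ℝ E ≤ s.card)
    {v : E} (hv : v ≠ 0) :
    ∃ δ : ι → ℝ, δ ≠ 0 ∧ (∀ i, i ∉ s → δ i = 0) ∧
      (∑ i, δ i • g i = 0 ∨ ∑ i, δ i • g i = v) := by
  classical
  have extend (c : s → ℝ) : ∃ δ : ι → ℝ, (∀ i, i ∉ s → δ i = 0) ∧ (∀ i : s, δ i = c i) ∧
      ∑ i, δ i • g i = ∑ i : s, c i • g i := by
    refine ⟨fun i => if h : i ∈ s then c ⟨i, h⟩ else 0, fun i hi => by simp [hi],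
      fun i => by simp, ?_⟩
    rw [← Finset.sum_subset (Finset.subset_univ s) (fun i _ hi => by simp [hi]),
      ← Finset.sum_coe_sort s]
    exact Finset.sum_congr rfl fun i _ => by simp
  by_cases hli : LinearIndependent ℝ (fun i : s => g i)
  · have hspan := hli.span_eq_top_of_card_eq_finrank'
      (le_antisymm hli.fintype_card_le_finrank (by simpa using hs))
    obtain ⟨c, hc⟩ := (Submodule.mem_span_range_iff_exists_fun ℝ).1
      (hspan ▸ Submodule.mem_top : v ∈ Submodule.span ℝ (Set.range fun i : s => g i))
    obtain ⟨δ, h₀, -, hsum⟩ := extend c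
    refine ⟨δ, ?_, h₀, Or.inr (hsum.trans hc)⟩
    rintro rfl
    exact hv (by rw [← hc, ← hsum]; simp)
  · obtain ⟨c, hc, i, hi⟩ := Fintype.not_linearIndependent_iff.1 hli
    obtain ⟨δ, h₀, h₁, hsum⟩ := extend c
    exact ⟨δ, fun h => hi (by rw [← h₁ i, h]; rfl), h₀, Or.inl (hsum.trans hc)⟩

/-- Weights on two finite sets of points of the plane, each family summing to `1`, can be chosen
with at most three nonzero entries when the weighted sum is only required to stay below `z`. -/
theorem exists_weights_card_le_three {ι κ : Type*} [Fintype ι] [Fintype κ]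
    (p : ι → Fin 2 → ℝ) (q : κ → Fin 2 → ℝ) (z : Fin 2 → ℝ) (w : ι ⊕ κ → ℝ)
    (hw : ∀ i, 0 ≤ w i) (hp : ∑ i, w (.inl i) = 1) (hq : ∑ i, w (.inr i) = 1)
    (hz : ∑ i, w (.inl i) • p i + ∑ i, w (.inr i) • q i ≤ z) :
    ∃ w : ι ⊕ κ → ℝ, (∀ i, 0 ≤ w i) ∧ ∑ i, w (.inl i) = 1 ∧ ∑ i, w (.inr i) = 1 ∧
      ∑ i, w (.inl i) • p i + ∑ i, w (.inr i) • q i ≤ z ∧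
      (Finset.univ.filter fun i => w i ≠ 0).card ≤ 3 := by
  classical
  induction hn : (Finset.univ.filter fun i => w i ≠ 0).card using Nat.strong_induction_on
    generalizing w with
  | _ n ih =>
  by_cases h3 : n ≤ 3
  · exact ⟨w, hw, hp, hq, hz, hn ▸ h3⟩
  let g : ι ⊕ κ → (Fin 2 → ℝ) × ℝ × ℝ :=
    Sum.elim (fun i => (p i, 1, 0)) (fun i => (q i, 0, 1))
  have hv : ((-1, 0, 0) : (Fin 2 → ℝ) × ℝ × ℝ) ≠ 0 := by
    intro h
    have := congrFun (congrArg Prod.fst h) 0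
    norm_num at this
  have hrank : Module.finrank ℝ ((Fin 2 → ℝ) × ℝ × ℝ) ≤
      (Finset.univ.filter fun i => w i ≠ 0).card := by
    rw [hn, Module.finrank_prod, Module.finrank_prod, Module.finrank_fin_fun,
      Module.finrank_self]
    omega
  obtain ⟨δ, hδ, hsupp, hsum⟩ := exists_sum_smul_eq_zero_or_eq g
    (Finset.univ.filter fun i => w i ≠ 0) hrank hv
  have hδp : ∑ i, δ (.inl i) = 0 := by
    rcases hsum with h | h <;>
    · have := congrArg (fun x => x.2.1) h
      simpa [g, Fintype.sum_sum_type, Prod.fst_sum, Prod.snd_sum] using this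
  have hδq : ∑ i, δ (.inr i) = 0 := by
    rcases hsum with h | h <;>
    · have := congrArg (fun x => x.2.2) h
      simpa [g, Fintype.sum_sum_type, Prod.fst_sum, Prod.snd_sum] using this
  have hδz : ∑ i, δ (.inl i) • p i + ∑ i, δ (.inr i) • q i ≤ 0 := by
    rcases hsum with h | h
    · have := congrArg (fun x => x.1) h
      simp only [g, Fintype.sum_sum_type, Prod.fst_sum, Prod.fst_add, Sum.elim_inl,
        Sum.elim_inr, Prod.smul_fst, Prod.fst_zero] at this
      exact this.le
    · have := congrArg (fun x => x.1) h
      simp only [g, Fintype.sum_sum_type, Prod.fst_sum, Prod.fst_add, Sum.elim_inl,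
        Sum.elim_inr, Prod.smul_fst] at this
      rw [this]
      intro i
      simp
  have hneg : ∃ i, δ i < 0 := by
    by_contra! hpos
    refine hδ (funext fun i => ?_)
    have htot : ∑ i, δ i = 0 := by rw [Fintype.sum_sum_type, hδp, hδq, add_zero]
    exact (Finset.sum_eq_zero_iff_of_nonneg fun i _ => hpos i).1 htot i (Finset.mem_univ i)
  have hδ0 : ∀ i, w i = 0 → δ i = 0 := fun i hi => hsupp i (by simp [hi])
  obtain ⟨t, ht, hnn, i, hwi, hi⟩ := exists_nonneg_add_mul_eq_zero w δ hw hδ0 hneg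
  refine ih _ ?_ (fun i => w i + t * δ i) hnn ?_ ?_ ?_ rfl
  · rw [← hn]
    refine Finset.card_lt_card (Finset.ssubset_iff_of_subset ?_ |>.2 ⟨i, by simpa using hwi, ?_⟩)
    · intro k
      simp only [Finset.mem_filter, Finset.mem_univ, true_and]
      intro hk h
      exact hk (by rw [h, hδ0 k h]; ring)
    · simpa using hi
  · rw [Finset.sum_add_distrib, ← Finset.mul_sum, hp, hδp]; ring
  · rw [Finset.sum_add_distrib, ← Finset.mul_sum, hq, hδq]; ring
  · have hsum_eq : ∑ i, (w (.inl i) + t * δ (.inl i)) • p i +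
        ∑ i, (w (.inr i) + t * δ (.inr i)) • q i =
        (∑ i, w (.inl i) • p i + ∑ i, w (.inr i) • q i) +
          t • (∑ i, δ (.inl i) • p i + ∑ i, δ (.inr i) • q i) := by
      simp only [add_smul, mul_smul, Finset.sum_add_distrib, ← Finset.smul_sum, smul_add]
      abel
    rw [hsum_eq, ← add_zero z]
    exact add_le_add hz (smul_nonpos_of_nonneg_of_nonpos ht hδz)

/-- Weights summing to `1` with at most one nonzero entry are concentrated at a point. -/
theorem exists_sum_smul_eq_of_card_le_one {ι E : Type*} [Fintype ι] [AddCommGroup E]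
    [Module ℝ E] (p : ι → E) (w : ι → ℝ) (hw : ∑ i, w i = 1)
    (hcard : (Finset.univ.filter fun i => w i ≠ 0).card ≤ 1) :
    ∃ a, ∑ i, w i • p i = p a := by
  classical
  obtain ⟨a, ha⟩ : ∃ a, w a ≠ 0 := by
    by_contra! h
    simp [h] at hw
  have h0 : ∀ i, i ≠ a → w i = 0 := by
    intro i hi
    by_contra hwi
    exact hi (Finset.card_le_one.1 hcard i (by simpa using hwi) a (by simpa using ha))
  refine ⟨a, ?_⟩
  rw [Finset.sum_eq_single a (fun i _ hi => h0 i hi) (by simp)] at hw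
  rw [Finset.sum_eq_single a (fun i _ hi => by rw [h0 i hi, zero_smul]) (by simp), hw, one_smul]

theorem mem_convexHull_add_nonneg_iff {s : Finset (Fin 2 → ℝ)} {z : Fin 2 → ℝ} :
    z ∈ convexHull ℝ (s : Set (Fin 2 → ℝ)) + {z : Fin 2 → ℝ | ∀ i, 0 ≤ z i} ↔
      ∃ w : s → ℝ, (∀ i, 0 ≤ w i) ∧ ∑ i, w i = 1 ∧ ∑ i, w i • (i : Fin 2 → ℝ) ≤ z := by
  classical
  constructor
  · rintro ⟨x, hx, r, hr, rfl⟩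
    obtain ⟨w, hw, hw1, rfl⟩ := Finset.mem_convexHull'.1 hx
    refine ⟨fun i => w i, fun i => hw i i.2, ?_, ?_⟩
    · rwa [Finset.sum_coe_sort s w]
    · rw [Finset.sum_coe_sort s fun i => w i • i]
      exact le_add_of_nonneg_right hr
  · rintro ⟨w, hw, hw1, hz⟩
    refine ⟨∑ i, w i • (i : Fin 2 → ℝ), ?_, z - ∑ i, w i • (i : Fin 2 → ℝ),
      fun i => sub_nonneg.2 (hz i), by simp⟩
    exact (convex_convexHull ℝ _).sum_mem (fun i _ => hw i) hw1
      fun i _ => subset_convexHull ℝ _ i.2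

/-- A point of the sum of two polyhedra in the plane with recession cone the positive quadrant
differs by a generator of one of them from a point of the other. -/
theorem exists_sub_mem_of_mem_add (s t : Finset (Fin 2 → ℝ)) (z : Fin 2 → ℝ)
    (hz : z ∈ (convexHull ℝ (s : Set (Fin 2 → ℝ)) + {z : Fin 2 → ℝ | ∀ i, 0 ≤ z i}) +
      (convexHull ℝ (t : Set (Fin 2 → ℝ)) + {z : Fin 2 → ℝ | ∀ i, 0 ≤ z i})) :
    (∃ a ∈ s, z - a ∈ convexHull ℝ (t : Set (Fin 2 → ℝ)) + {z : Fin 2 → ℝ | ∀ i, 0 ≤ z i}) ∨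
      ∃ b ∈ t, z - b ∈ convexHull ℝ (s : Set (Fin 2 → ℝ)) + {z : Fin 2 → ℝ | ∀ i, 0 ≤ z i} := by
  classical
  obtain ⟨x, hx, y, hy, rfl⟩ := hz
  obtain ⟨wx, hwx, hwx1, hxle⟩ := mem_convexHull_add_nonneg_iff.1 hx
  obtain ⟨wy, hwy, hwy1, hyle⟩ := mem_convexHull_add_nonneg_iff.1 hy
  obtain ⟨w, hw, hs, ht, hle, hcard⟩ := exists_weights_card_le_three
    (fun i : s => (i : Fin 2 → ℝ)) (fun i : t => (i : Fin 2 → ℝ)) (x + y) (Sum.elim wx wy)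
    (by rintro (i | i); exacts [hwx i, hwy i]) hwx1 hwy1 (add_le_add hxle hyle)
  have hsplit : (Finset.univ.filter fun i => w i ≠ 0).card =
      (Finset.univ.filter fun i : s => w (.inl i) ≠ 0).card +
        (Finset.univ.filter fun i : t => w (.inr i) ≠ 0).card := by
    simp only [Finset.card_filter, Fintype.sum_sum_type]
  rcases (by omega : (Finset.univ.filter fun i : s => w (.inl i) ≠ 0).card ≤ 1 ∨
      (Finset.univ.filter fun i : t => w (.inr i) ≠ 0).card ≤ 1) with h | h
  · obtain ⟨a, ha⟩ := exists_sum_smul_eq_of_card_le_one (fun i : s => (i : Fin 2 → ℝ)) _ hs h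
    refine Or.inl ⟨a, a.2, mem_convexHull_add_nonneg_iff.2 ⟨_, fun i => hw (.inr i), ht, ?_⟩⟩
    rw [ha] at hle
    exact le_sub_iff_add_le'.2 hle
  · obtain ⟨b, hb⟩ := exists_sum_smul_eq_of_card_le_one (fun i : t => (i : Fin 2 → ℝ)) _ ht h
    refine Or.inr ⟨b, b.2, mem_convexHull_add_nonneg_iff.2 ⟨_, fun i => hw (.inl i), hs, ?_⟩⟩
    rw [hb] at hle
    exact le_sub_iff_add_le.2 hle

/-- let `K₁, K₂` be convex hulls of nonempty finite subsets of `ℤ² ⊂ ℝ²` and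
`Qⱼ = Kⱼ + [0,∞)²`. If for every `u ∈ ℝ²` the linear functional `z ↦ ⟨u,z⟩` attains its
minimum on `Q₁` at a unique point iff it attains its minimum on `Q₂` at a unique point, then
`(Q₁ + Q₂) ∩ ℤ² = (Q₁ ∩ ℤ²) + (Q₂ ∩ ℤ²)`. -/
theorem stmt6 (S₁ S₂ : Set (Fin 2 → ℝ))
    (hS₁fin : S₁.Finite) (hS₂fin : S₂.Finite)
    (hS₁ne : S₁.Nonempty) (hS₂ne : S₂.Nonempty)
    (hS₁int : ∀ z ∈ S₁, ∀ i, ∃ n : ℤ, z i = n)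
    (hS₂int : ∀ z ∈ S₂, ∀ i, ∃ n : ℤ, z i = n)
    (Q₁ Q₂ : Set (Fin 2 → ℝ))
    (hQ₁ : Q₁ = convexHull ℝ S₁ + {z : Fin 2 → ℝ | ∀ i, 0 ≤ z i})
    (hQ₂ : Q₂ = convexHull ℝ S₂ + {z : Fin 2 → ℝ | ∀ i, 0 ≤ z i})
    (hfan : ∀ u : Fin 2 → ℝ,
      (∃! x, x ∈ Q₁ ∧ ∀ y ∈ Q₁, u 0 * x 0 + u 1 * x 1 ≤ u 0 * y 0 + u 1 * y 1) ↔
      (∃! x, x ∈ Q₂ ∧ ∀ y ∈ Q₂, u 0 * x 0 + u 1 * x 1 ≤ u 0 * y 0 + u 1 * y 1)) :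
    (Q₁ + Q₂) ∩ {z | ∀ i, ∃ n : ℤ, z i = n} =
      (Q₁ ∩ {z | ∀ i, ∃ n : ℤ, z i = n}) + (Q₂ ∩ {z | ∀ i, ∃ n : ℤ, z i = n}) := by
  have hsub : ∀ z w : Fin 2 → ℝ, (∀ i, ∃ n : ℤ, z i = n) → (∀ i, ∃ n : ℤ, w i = n) →
      ∀ i, ∃ n : ℤ, (z - w) i = n := by
    intro z w hz hw i
    obtain ⟨m, hm⟩ := hz i
    obtain ⟨n, hn⟩ := hw i
    exact ⟨m - n, by simp [hm, hn]⟩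
  have hgen : ∀ S : Set (Fin 2 → ℝ), ∀ a ∈ S,
      a ∈ convexHull ℝ S + {z : Fin 2 → ℝ | ∀ i, 0 ≤ z i} := fun S a ha =>
    ⟨a, subset_convexHull ℝ S ha, 0, fun _ => le_rfl, add_zero a⟩
  lift S₁ to Finset (Fin 2 → ℝ) using hS₁fin
  lift S₂ to Finset (Fin 2 → ℝ) using hS₂fin
  subst hQ₁ hQ₂
  apply Set.Subset.antisymm
  · rintro z ⟨hz, hzint⟩
    rcases exists_sub_mem_of_mem_add S₁ S₂ z hz with ⟨a, ha, h⟩ | ⟨b, hb, h⟩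
    · exact ⟨a, ⟨hgen _ a ha, hS₁int a ha⟩, z - a, ⟨h, hsub z a hzint (hS₁int a ha)⟩,
        add_sub_cancel a z⟩
    · exact ⟨z - b, ⟨h, hsub z b hzint (hS₂int b hb)⟩, b, ⟨hgen _ b hb, hS₂int b hb⟩,
        sub_add_cancel z b⟩
  · rintro _ ⟨x, ⟨hx, hxint⟩, y, ⟨hy, hyint⟩, rfl⟩
    refine ⟨Set.add_mem_add hx hy, fun i => ?_⟩
    obtain ⟨m, hm⟩ := hxint i
    obtain ⟨n, hn⟩ := hyint i
    exact ⟨m + n, by simp [hm, hn]⟩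
end

section
/- Let a₁, a₂ ≥ 1 be integers. For j = 1, 2 let T_j ⊂ ℝ² be the triangle (convex hull) with vertices (u_j, w_j), (U_j, W_j), (U_j, w_j) ∈ ℤ², where u_j ≤ U_j, W_j ≤ w_j and a₁(U_j − u_j) = a₂(w_j − W_j). Then ((T₁ + T₂) + [0,∞)²) ∩ ℤ² = ((T₁ + [0,∞)²) ∩ ℤ²) + ((T₂ + [0,∞)²) ∩ ℤ²), where + denotes Minkowski sum; here T₁ + T₂ is the triangle with vertices (u₁+u₂, w₁+w₂), (U₁+U₂, W₁+W₂), (U₁+U₂, w₁+w₂). -/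
open scoped Pointwise

/-- The Minkowski sum of a right triangle with the closed first quadrant, described by the
inequalities of its three edges. -/
theorem mem_convexHull_triangle_add_quadrant_iff {a b u U w W : ℝ} (ha : 0 < a) (hb : 0 < b)
    (huU : u ≤ U) (hWw : W ≤ w) (hslope : a * (U - u) = b * (w - W)) (p : ℝ × ℝ) :
    p ∈ convexHull ℝ {((u, w) : ℝ × ℝ), (U, W), (U, w)} + {p : ℝ × ℝ | 0 ≤ p.1 ∧ 0 ≤ p.2} ↔
      u ≤ p.1 ∧ W ≤ p.2 ∧ a * u + b * w ≤ a * p.1 + b * p.2 := by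
  constructor
  · rintro ⟨q, hq, r, ⟨hr₁, hr₂⟩, rfl⟩
    have hconv : Convex ℝ {q : ℝ × ℝ | u ≤ q.1 ∧ W ≤ q.2 ∧ a * u + b * w ≤ a * q.1 + b * q.2} := by
      rintro x ⟨hx₁, hx₂, hx₃⟩ y ⟨hy₁, hy₂, hy₃⟩ s t hs ht hst
      obtain rfl : t = 1 - s := by linarith
      simp only [Set.mem_ofPred_eq, Prod.fst_add, Prod.snd_add, Prod.smul_fst, Prod.smul_snd,
        smul_eq_mul]
      refine ⟨?_, ?_, ?_⟩ <;> nlinarith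
    have hvert : ({((u, w) : ℝ × ℝ), (U, W), (U, w)} : Set (ℝ × ℝ)) ⊆
        {q | u ≤ q.1 ∧ W ≤ q.2 ∧ a * u + b * w ≤ a * q.1 + b * q.2} := by
      rintro _ (rfl | rfl | rfl)
      · exact ⟨le_rfl, hWw, le_rfl⟩
      · exact ⟨huU, le_rfl, by linarith⟩
      · exact ⟨huU, hWw, by nlinarith⟩
    obtain ⟨h₁, h₂, h₃⟩ := convexHull_min hvert hconv hq
    have := mul_nonneg ha.le hr₁
    have := mul_nonneg hb.le hr₂
    simp only [Prod.fst_add, Prod.snd_add]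
    refine ⟨by linarith, by linarith, by linarith⟩
  · rintro ⟨h₁, h₂, h₃⟩
    rcases le_or_gt U p.1 with h | h
    · exact ⟨(U, W), subset_convexHull ℝ _ (by simp), p - (U, W), by simp [h, h₂], by simp⟩
    · have hpos : 0 < U - u := by linarith
      set t := (p.1 - u) / (U - u)
      have ht₀ : 0 ≤ t := div_nonneg (by linarith) hpos.le
      have ht₁ : t ≤ 1 := (div_le_one hpos).2 (by linarith)
      have hpt : p.1 = (1 - t) * u + t * U := by
        have : t * (U - u) = p.1 - u := div_mul_cancel₀ _ hpos.ne'
        linarith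
      have hmem : (1 - t) • ((u, w) : ℝ × ℝ) + t • (U, W) ∈
          convexHull ℝ {((u, w) : ℝ × ℝ), (U, W), (U, w)} :=
        convex_convexHull ℝ _ (subset_convexHull ℝ _ (by simp)) (subset_convexHull ℝ _ (by simp))
          (by linarith) ht₀ (by ring)
      refine ⟨_, hmem, p - ((1 - t) • ((u, w) : ℝ × ℝ) + t • (U, W)), ?_, by simp⟩
      simp only [Set.mem_ofPred_eq, Prod.fst_sub, Prod.snd_sub, Prod.fst_add, Prod.snd_add,
        Prod.smul_fst, Prod.smul_snd, smul_eq_mul]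
      refine ⟨by linarith, nonneg_of_mul_nonneg_right ?_ hb⟩
      rw [hpt] at h₃
      linear_combination h₃ + t * hslope

/-- An integer point in the sum of two truncated quadrants with parallel slanted edges is a sum
of integer points of the two. -/
theorem exists_int_decomposition {a b u₀ U₀ w₀ W₀ u₁ U₁ w₁ W₁ m n : ℤ} (ha : 1 ≤ a) (hb : 1 ≤ b)
    (hu₀ : u₀ ≤ U₀) (hw₀ : W₀ ≤ w₀) (hs₀ : a * (U₀ - u₀) = b * (w₀ - W₀))
    (hu₁ : u₁ ≤ U₁) (hw₁ : W₁ ≤ w₁) (hs₁ : a * (U₁ - u₁) = b * (w₁ - W₁))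
    (hm : u₀ + u₁ ≤ m) (hn : W₀ + W₁ ≤ n)
    (hmn : (a * u₀ + b * w₀) + (a * u₁ + b * w₁) ≤ a * m + b * n) :
    ∃ k l : ℤ, (u₀ ≤ k ∧ W₀ ≤ l ∧ a * u₀ + b * w₀ ≤ a * k + b * l) ∧
      (u₁ ≤ m - k ∧ W₁ ≤ n - l ∧ a * u₁ + b * w₁ ≤ a * (m - k) + b * (n - l)) := by
  by_cases h₁ : U₀ + u₁ ≤ m
  · exact ⟨U₀, W₀, by refine ⟨?_, ?_, ?_⟩ <;> linarith, by refine ⟨?_, ?_, ?_⟩ <;> linarith⟩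
  by_cases h₂ : w₀ + W₁ ≤ n
  · exact ⟨u₀, w₀, by refine ⟨?_, ?_, ?_⟩ <;> linarith, by refine ⟨?_, ?_, ?_⟩ <;> linarith⟩
  by_cases h₃ : u₀ + U₁ ≤ m
  · exact ⟨m - U₁, n - W₁, by refine ⟨?_, ?_, ?_⟩ <;> linarith, by refine ⟨?_, ?_, ?_⟩ <;> linarith⟩
  by_cases h₄ : W₀ + w₁ ≤ n
  · exact ⟨m - u₁, n - w₁, by refine ⟨?_, ?_, ?_⟩ <;> linarith, by refine ⟨?_, ?_, ?_⟩ <;> linarith⟩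
  push Not at h₁ h₂ h₃ h₄
  have e₁ := mul_lt_mul_of_pos_left h₁ (by linarith : 0 < a)
  have e₂ := mul_lt_mul_of_pos_left h₂ (by linarith : 0 < b)
  have e₃ := mul_lt_mul_of_pos_left h₃ (by linarith : 0 < a)
  have e₄ := mul_lt_mul_of_pos_left h₄ (by linarith : 0 < b)
  linarith

/-- for `j = 0, 1` let `T j` be the lattice right triangle with vertices
`(u j, w j)`, `(U j, W j)`, `(U j, w j)` where `u j ≤ U j`, `W j ≤ w j` and
`a₁ (U j − u j) = a₂ (w j − W j)` for fixed integers `a₁, a₂ ≥ 1`. Then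
`((T₀ + T₁) + [0,∞)²) ∩ ℤ² = ((T₀ + [0,∞)²) ∩ ℤ²) + ((T₁ + [0,∞)²) ∩ ℤ²)`. -/
theorem stmt7 (a₁ a₂ : ℤ) (ha₁ : 1 ≤ a₁) (ha₂ : 1 ≤ a₂)
    (u U w W : Fin 2 → ℤ)
    (huU : ∀ j, u j ≤ U j) (hWw : ∀ j, W j ≤ w j)
    (hslope : ∀ j, a₁ * (U j - u j) = a₂ * (w j - W j))
    (T : Fin 2 → Set (ℝ × ℝ))
    (hT : ∀ j, T j = convexHull ℝ
      {(((u j : ℝ), (w j : ℝ)) : ℝ × ℝ), ((U j : ℝ), (W j : ℝ)), ((U j : ℝ), (w j : ℝ))}) :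
    ((T 0 + T 1) + {p : ℝ × ℝ | 0 ≤ p.1 ∧ 0 ≤ p.2}) ∩
        {p : ℝ × ℝ | ∃ m n : ℤ, p = ((m : ℝ), (n : ℝ))} =
      ((T 0 + {p : ℝ × ℝ | 0 ≤ p.1 ∧ 0 ≤ p.2}) ∩ {p | ∃ m n : ℤ, p = ((m : ℝ), (n : ℝ))}) +
      ((T 1 + {p : ℝ × ℝ | 0 ≤ p.1 ∧ 0 ≤ p.2}) ∩ {p | ∃ m n : ℤ, p = ((m : ℝ), (n : ℝ))}) := by
  have ha : (0 : ℝ) < a₁ := by exact_mod_cast ha₁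
  have hb : (0 : ℝ) < a₂ := by exact_mod_cast ha₂
  have key (j : Fin 2) (p : ℝ × ℝ) : p ∈ T j + {p : ℝ × ℝ | 0 ≤ p.1 ∧ 0 ≤ p.2} ↔
      (u j : ℝ) ≤ p.1 ∧ (W j : ℝ) ≤ p.2 ∧
        (a₁ : ℝ) * u j + a₂ * w j ≤ a₁ * p.1 + a₂ * p.2 := by
    rw [hT j]
    exact mem_convexHull_triangle_add_quadrant_iff ha hb (by exact_mod_cast huU j)
      (by exact_mod_cast hWw j) (by exact_mod_cast hslope j) p
  ext p
  constructor
  · rintro ⟨⟨_, ⟨q₀, hq₀, q₁, hq₁, rfl⟩, r, hr, hp⟩, m, n, rfl⟩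
    obtain ⟨h₁, h₂, h₃⟩ := (key 0 (q₀ + r)).1 (Set.add_mem_add hq₀ hr)
    obtain ⟨k₁, k₂, k₃⟩ := (key 1 q₁).1 ⟨q₁, hq₁, 0, by simp, by simp⟩
    obtain ⟨hm, hn⟩ := Prod.ext_iff.1 hp
    simp only [Prod.fst_add, Prod.snd_add] at h₁ h₂ h₃ hm hn
    obtain ⟨k, l, ⟨c₁, c₂, c₃⟩, d₁, d₂, d₃⟩ := exists_int_decomposition (m := m) (n := n) ha₁ ha₂
      (huU 0) (hWw 0) (hslope 0) (huU 1) (hWw 1) (hslope 1)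
      (by rify; linarith) (by rify; linarith) (by rify; rw [← hm, ← hn]; linarith)
    refine ⟨((k : ℝ), (l : ℝ)), ⟨(key 0 _).2 ⟨?_, ?_, ?_⟩, k, l, rfl⟩,
      (((m - k : ℤ) : ℝ), ((n - l : ℤ) : ℝ)),
      ⟨(key 1 _).2 ⟨?_, ?_, ?_⟩, m - k, n - l, rfl⟩, by simp⟩
    all_goals
      dsimp only
      exact_mod_cast by assumption
  · rintro ⟨_, ⟨⟨q₀, hq₀, r₀, hr₀, rfl⟩, m₀, n₀, h₀⟩, _,
      ⟨⟨q₁, hq₁, r₁, hr₁, rfl⟩, m₁, n₁, h₁⟩, rfl⟩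
    refine ⟨⟨q₀ + q₁, Set.add_mem_add hq₀ hq₁, r₀ + r₁,
      ⟨add_nonneg hr₀.1 hr₁.1, add_nonneg hr₀.2 hr₁.2⟩, add_add_add_comm _ _ _ _⟩,
      m₀ + m₁, n₀ + n₁, ?_⟩
    simp only at h₀ h₁ ⊢
    rw [h₀, h₁]
    simp
end

section
/- Let l ≥ 2, n ≥ 1. Let a₁,…,a_n ∈ ℤ satisfy, with a₀ := 0, the conditions 2aᵢ ≥ a_{i−1} + a_{i+1} for 1 ≤ i ≤ n−1 and a_n ≥ a_{n−1}; let c₁,…,c_n ∈ ℤ satisfy the same conditions (with c₀ := 0). Define Q(a) = {z ∈ ℝ^l : z_j ≥ 0 for all j, and i(z₁ + ⋯ + z_{l−1}) + z_l ≥ aᵢ for all 1 ≤ i ≤ n}, and likewise Q(c) and Q(a+c) (using aᵢ + cᵢ). Then Q(a+c) ∩ ℤ^l = (Q(a) ∩ ℤ^l) + (Q(c) ∩ ℤ^l), where + denotes Minkowski sum. -/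
open scoped Pointwise

/-- The polyhedron `Q(a) = {z ∈ ℝ^l : z_j ≥ 0 ∀j, i(z₁+⋯+z_{l−1}) + z_l ≥ a_i, 1 ≤ i ≤ n}`
(coordinates `z₁,…,z_l` are `z 0, …, z ⟨l-1⟩`). -/
def Qblowups (l : ℕ) (hl : 2 ≤ l) (n : ℕ) (a : ℕ → ℤ) : Set (Fin l → ℝ) :=
  {z | (∀ j, 0 ≤ z j) ∧ ∀ i : ℕ, 1 ≤ i → i ≤ n →
    (a i : ℝ) ≤ (i : ℝ) * (∑ j ∈ Finset.univ.filter (fun j : Fin l => (j : ℕ) < l - 1), z j)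
      + z ⟨l - 1, by omega⟩}

/-- Any integer between `0` and `∑ m` is the sum of some `p` with `0 ≤ p ≤ m`. -/
theorem Finset.exists_le_sum_eq_int {ι : Type*} (S : Finset ι) (m : ι → ℤ) (hm : ∀ j, 0 ≤ m j)
    (s : ℤ) (hs : 0 ≤ s) (hsm : s ≤ ∑ j ∈ S, m j) :
    ∃ p : ι → ℤ, (∀ j, 0 ≤ p j ∧ p j ≤ m j) ∧ ∑ j ∈ S, p j = s := by
  classical
  induction S using Finset.induction_on generalizing s with
  | empty =>
    refine ⟨fun _ => 0, fun j => ⟨le_rfl, hm j⟩, ?_⟩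
    simp only [Finset.sum_empty] at hsm ⊢
    omega
  | insert x S hx ih =>
    rw [Finset.sum_insert hx] at hsm
    have hsum : 0 ≤ ∑ j ∈ S, m j := Finset.sum_nonneg fun j _ => hm j
    obtain ⟨p, hp, hps⟩ := ih (min s (∑ j ∈ S, m j)) (by omega) (by omega)
    have hmx := hm x
    refine ⟨Function.update p x (s - min s (∑ j ∈ S, m j)), fun j => ?_, ?_⟩
    · rcases eq_or_ne j x with rfl | hj
      · rw [Function.update_self]
        omega
      · rw [Function.update_of_ne hj]
        exact hp j
    · rw [Finset.sum_insert hx, Function.update_self, Finset.sum_update_of_notMem hx, hps]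
      omega

/-- The increments of a concave sequence are antitone. -/
theorem increment_le_of_concave {n : ℕ} {a : ℕ → ℤ}
    (ha : ∀ i : ℕ, 1 ≤ i → i + 1 ≤ n → a (i - 1) + a (i + 1) ≤ 2 * a i)
    {i j : ℕ} (hij : i ≤ j) (hj : j < n) : a (j + 1) - a j ≤ a (i + 1) - a i := by
  induction j, hij using Nat.le_induction with
  | base => exact le_rfl
  | succ j hij ih =>
    have h := ha (j + 1) (by omega) (by omega)
    rw [Nat.add_sub_cancel] at h
    have := ih (by omega)
    omega

/-- For a concave sequence, a local maximum of `i ↦ a i - i * s` is a global one. -/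
theorem sub_mul_le_of_concave {n : ℕ} {a : ℕ → ℤ}
    (ha : ∀ i : ℕ, 1 ≤ i → i + 1 ≤ n → a (i - 1) + a (i + 1) ≤ 2 * a i)
    {k : ℕ} (hk : k ≤ n) {s : ℤ} (hl : ∀ j, j + 1 = k → s ≤ a (j + 1) - a j)
    (hr : k < n → a (k + 1) - a k ≤ s) {i : ℕ} (hi : i ≤ n) :
    a i - i * s ≤ a k - k * s := by
  rcases le_total k i with h | h
  · induction i, h using Nat.le_induction with
    | base => exact le_rfl
    | succ i hki ih =>
      have h1 := increment_le_of_concave ha hki (by omega)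
      have h2 := hr (by omega)
      have h3 := ih (by omega)
      push_cast
      linarith
  · induction h using Nat.decreasingInduction with
    | self => exact le_rfl
    | of_succ i hik ih =>
      obtain ⟨j, rfl⟩ : ∃ j, k = j + 1 := ⟨k - 1, by omega⟩
      have h1 := increment_le_of_concave ha (show i ≤ j by omega) (by omega)
      have h2 := hl j rfl
      have h3 := ih (by omega)
      push_cast at h3 ⊢
      linarith

/-- A common index `k` at which a splitting `s = s₁ + s₂` makes both `i ↦ a i - i * s₁` and
`i ↦ c i - i * s₂` maximal. -/
theorem exists_common_maximizer {n : ℕ} (hn : 1 ≤ n) {a c : ℕ → ℤ}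
    (haconv : ∀ i : ℕ, 1 ≤ i → i + 1 ≤ n → a (i - 1) + a (i + 1) ≤ 2 * a i)
    (haend : a (n - 1) ≤ a n)
    (hcconv : ∀ i : ℕ, 1 ≤ i → i + 1 ≤ n → c (i - 1) + c (i + 1) ≤ 2 * c i)
    (hcend : c (n - 1) ≤ c n) {s : ℤ} (hs : 0 ≤ s) :
    ∃ k ≤ n, ∃ s₁, 0 ≤ s₁ ∧ s₁ ≤ s ∧ (∀ i ≤ n, a i - i * s₁ ≤ a k - k * s₁) ∧
      ∀ i ≤ n, c i - i * (s - s₁) ≤ c k - k * (s - s₁) := by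
  obtain ⟨k, hk, hmax⟩ := (Finset.range (n + 1)).exists_max_image
    (fun i => a i + c i - i * s) ⟨0, by simp⟩
  replace hk : k ≤ n := by simpa [Nat.lt_succ_iff] using hk
  replace hmax : ∀ i ≤ n, a i + c i - i * s ≤ a k + c k - k * s := fun i hi =>
    hmax i (Finset.mem_range.2 (by omega))
  have incr_nonneg : ∀ {b : ℕ → ℤ},
      (∀ i : ℕ, 1 ≤ i → i + 1 ≤ n → b (i - 1) + b (i + 1) ≤ 2 * b i) → b (n - 1) ≤ b n →
      ∀ i < n, 0 ≤ b (i + 1) - b i := by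
    intro b hb hbend i hi
    have h := increment_le_of_concave hb (show i ≤ n - 1 by omega) (by omega)
    rw [Nat.sub_add_cancel hn] at h
    omega
  have hl : ∀ j, j + 1 = k → s ≤ (a (j + 1) - a j) + (c (j + 1) - c j) := by
    rintro j rfl
    have h := hmax j (by omega)
    push_cast at h
    linarith
  have hr : k < n → (a (k + 1) - a k) + (c (k + 1) - c k) ≤ s := by
    intro hkn
    have h := hmax (k + 1) hkn
    push_cast at h
    linarith
  suffices h : ∃ s₁, 0 ≤ s₁ ∧ s₁ ≤ s ∧ (∀ j, j + 1 = k → s₁ ≤ a (j + 1) - a j) ∧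
      (k < n → a (k + 1) - a k ≤ s₁) ∧ (∀ j, j + 1 = k → s - s₁ ≤ c (j + 1) - c j) ∧
      (k < n → c (k + 1) - c k ≤ s - s₁) by
    obtain ⟨s₁, h0, h1, hla, hra, hlc, hrc⟩ := h
    exact ⟨k, hk, s₁, h0, h1, fun i hi => sub_mul_le_of_concave haconv hk hla hra hi,
      fun i hi => sub_mul_le_of_concave hcconv hk hlc hrc hi⟩
  have hak := incr_nonneg haconv haend
  have hck := incr_nonneg hcconv hcend
  rcases k with _ | j
  · have := hak 0 hn
    have := hck 0 hn
    have := hr hn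
    exact ⟨a (0 + 1) - a 0, by omega, by omega, by omega, by omega, by omega, by omega⟩
  · have := hak j hk
    have := hck j hk
    have := hl j rfl
    rcases hk.lt_or_eq with hlt | heq
    · have := hak (j + 1) hlt
      have := hck (j + 1) hlt
      have := hr hlt
      have := increment_le_of_concave haconv (Nat.le_succ j) hlt
      have := increment_le_of_concave hcconv (Nat.le_succ j) hlt
      simp only [Nat.succ_eq_add_one] at *
      refine ⟨max (a (j + 1 + 1) - a (j + 1)) (s - (c (j + 1) - c j)), by omega, by omega,
        ?_, by omega, ?_, by omega⟩
      all_goals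
        intro i hi
        obtain rfl : i = j := by omega
        omega
    · refine ⟨max 0 (s - (c (j + 1) - c j)), by omega, by omega, ?_, by omega, ?_, by omega⟩
      all_goals
        intro i hi
        obtain rfl : i = j := by omega
        omega

/-- Integer points of `Qblowups`, described by integer inequalities. -/
theorem intCast_mem_Qblowups {l : ℕ} (hl : 2 ≤ l) {n : ℕ} {a : ℕ → ℤ} {m : Fin l → ℤ} :
    (fun j => (m j : ℝ)) ∈ Qblowups l hl n a ↔ (∀ j, 0 ≤ m j) ∧ ∀ i : ℕ, 1 ≤ i → i ≤ n →
      a i ≤ i * (∑ j ∈ Finset.univ.filter (fun j : Fin l => (j : ℕ) < l - 1), m j)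
        + m ⟨l - 1, by omega⟩ := by
  simp only [Qblowups, Set.mem_ofPred_eq, Int.cast_nonneg_iff]
  exact_mod_cast Iff.rfl

/-- with `a₀ = c₀ = 0`, `2aᵢ ≥ a_{i−1} + a_{i+1}` for `1 ≤ i ≤ n−1`,
`a_n ≥ a_{n−1}` (and likewise for `c`), one has
`Q(a+c) ∩ ℤ^l = (Q(a) ∩ ℤ^l) + (Q(c) ∩ ℤ^l)`. -/
theorem stmt8 (l n : ℕ) (hl : 2 ≤ l) (hn : 1 ≤ n) (a c : ℕ → ℤ)
    (ha0 : a 0 = 0) (hc0 : c 0 = 0)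
    (haconv : ∀ i : ℕ, 1 ≤ i → i + 1 ≤ n → a (i - 1) + a (i + 1) ≤ 2 * a i)
    (haend : a (n - 1) ≤ a n)
    (hcconv : ∀ i : ℕ, 1 ≤ i → i + 1 ≤ n → c (i - 1) + c (i + 1) ≤ 2 * c i)
    (hcend : c (n - 1) ≤ c n) :
    Qblowups l hl n (fun i => a i + c i) ∩ {z | ∀ j, ∃ m : ℤ, z j = m} =
      (Qblowups l hl n a ∩ {z | ∀ j, ∃ m : ℤ, z j = m}) +
      (Qblowups l hl n c ∩ {z | ∀ j, ∃ m : ℤ, z j = m}) := by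
  ext z
  simp only [Set.mem_add, Set.mem_inter_iff, Set.mem_ofPred_eq]
  constructor
  · rintro ⟨hz, hint⟩
    choose m hm using hint
    obtain rfl : z = fun j => (m j : ℝ) := funext hm
    obtain ⟨hm0, hmi⟩ := (intCast_mem_Qblowups hl).1 hz
    set S := Finset.univ.filter (fun j : Fin l => (j : ℕ) < l - 1) with hS
    set e : Fin l := ⟨l - 1, by omega⟩ with he
    have heS : e ∉ S := by simp [hS, he]
    set s := ∑ j ∈ S, m j with hs
    obtain ⟨k, hk, s₁, h0, h1, hA, hC⟩ := exists_common_maximizer hn haconv haend hcconv hcend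
      (s := s) (Finset.sum_nonneg fun j _ => hm0 j)
    obtain ⟨p, hp, hps⟩ := S.exists_le_sum_eq_int m hm0 s₁ h0 h1
    have hA0 := hA 0 n.zero_le
    have hC0 := hC 0 n.zero_le
    have hkm : a k + c k ≤ k * s + m e := by
      rcases Nat.eq_zero_or_pos k with rfl | hkpos
      · simpa [ha0, hc0] using hm0 e
      · exact hmi k hkpos hk
    simp only [ha0, hc0, Nat.cast_zero, zero_mul, sub_zero] at hA0 hC0
    set q := Function.update p e (a k - k * s₁) with hq
    have hqe : q e = a k - k * s₁ := Function.update_self ..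
    have hqS : ∑ j ∈ S, q j = s₁ := by rw [hq, Finset.sum_update_of_notMem heS, hps]
    have hqne : ∀ j, j ≠ e → q j = p j := fun j hj => Function.update_of_ne hj ..
    refine ⟨fun j => (q j : ℝ), ⟨(intCast_mem_Qblowups hl).2 ⟨fun j => ?_, fun i _ hi => ?_⟩,
        fun j => ⟨_, rfl⟩⟩, fun j => ((m j - q j : ℤ) : ℝ),
      ⟨(intCast_mem_Qblowups hl).2 ⟨fun j => ?_, fun i _ hi => ?_⟩, fun j => ⟨_, rfl⟩⟩, ?_⟩
    · rcases eq_or_ne j e with rfl | hj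
      · rwa [hqe]
      · rw [hqne j hj]
        exact (hp j).1
    · rw [← hS, ← he, hqS, hqe]
      linarith [hA i hi]
    · rcases eq_or_ne j e with rfl | hj
      · rw [hqe]
        linarith
      · rw [hqne j hj]
        linarith [(hp j).2]
    · rw [← hS, ← he, Finset.sum_sub_distrib, hqS, hqe, ← hs]
      linarith [hC i hi]
    · ext j
      simp
  · rintro ⟨x, ⟨⟨hx0, hxi⟩, hx⟩, y, ⟨⟨hy0, hyi⟩, hy⟩, rfl⟩
    refine ⟨⟨fun j => add_nonneg (hx0 j) (hy0 j), fun i h1 hi => ?_⟩, fun j => ?_⟩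
    · simp only [Pi.add_apply, Finset.sum_add_distrib, Int.cast_add]
      linarith [hxi i h1 hi, hyi i h1 hi]
    · obtain ⟨u, hu⟩ := hx j
      obtain ⟨v, hv⟩ := hy j
      exact ⟨u + v, by simp [hu, hv]⟩
end

section
/- Let l ≥ 1 and 1 ≤ r ≤ l. Let a₁,…,a_l, b and c₁,…,c_l, d be integers with b ≥ a₁ + ⋯ + a_r and d ≥ c₁ + ⋯ + c_r. Define Q(a,b) = {z ∈ ℝ^l : zᵢ ≥ aᵢ for all i, and z₁ + ⋯ + z_r ≥ b}, and likewise Q(c,d) and Q(a+c, b+d). Then Q(a+c, b+d) ∩ ℤ^l = (Q(a,b) ∩ ℤ^l) + (Q(c,d) ∩ ℤ^l), where + denotes Minkowski sum. -/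
open scoped Pointwise

/-- The polyhedron `Q(a,b) = {z ∈ ℝ^l : zᵢ ≥ aᵢ ∀i, z₁ + ⋯ + z_r ≥ b}`. -/
def Qblowup (l r : ℕ) (a : Fin l → ℤ) (b : ℤ) : Set (Fin l → ℝ) :=
  {z | (∀ i, (a i : ℝ) ≤ z i) ∧
    (b : ℝ) ≤ ∑ i ∈ Finset.univ.filter (fun i : Fin l => (i : ℕ) < r), z i}

/-- An integer between `∑ lo` and `∑ hi` is the sum over `s` of an integer vector lying between
`lo` and `hi`. -/
theorem Finset.exists_sum_eq_of_sum_le_of_le_sum {ι : Type*} (s : Finset ι) {lo hi : ι → ℤ}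
    (h : lo ≤ hi) {b : ℤ} (hlo : ∑ i ∈ s, lo i ≤ b) (hhi : b ≤ ∑ i ∈ s, hi i) :
    ∃ x, lo ≤ x ∧ x ≤ hi ∧ ∑ i ∈ s, x i = b := by
  classical
  induction s using Finset.induction_on generalizing b with
  | empty => exact ⟨lo, le_rfl, h, by simp_all; omega⟩
  | insert j s hj ih =>
    rw [Finset.sum_insert hj] at hlo hhi
    have hs : ∑ i ∈ s, lo i ≤ ∑ i ∈ s, hi i := Finset.sum_le_sum fun i _ => h i
    have hij := h j
    obtain ⟨v, hv₁, hv₂, hv₃, hv₄⟩ : ∃ v, lo j ≤ v ∧ v ≤ hi j ∧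
        ∑ i ∈ s, lo i ≤ b - v ∧ b - v ≤ ∑ i ∈ s, hi i :=
      ⟨max (lo j) (b - ∑ i ∈ s, hi i), by grind, by grind, by grind, by grind⟩
    obtain ⟨x, hx₁, hx₂, hx⟩ := ih hv₃ hv₄
    refine ⟨Function.update x j v, le_update_iff.2 ⟨hv₁, fun i _ => hx₁ i⟩,
      update_le_iff.2 ⟨hv₂, fun i _ => hx₂ i⟩, ?_⟩
    rw [Finset.sum_insert hj, Finset.sum_update_of_notMem hj, hx, Function.update_self]
    ring

/-- if `b ≥ a₁ + ⋯ + a_r` and `d ≥ c₁ + ⋯ + c_r`, then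
`Q(a+c, b+d) ∩ ℤ^l = (Q(a,b) ∩ ℤ^l) + (Q(c,d) ∩ ℤ^l)`. -/
theorem stmt9 (l r : ℕ) (hl : 1 ≤ l) (hr1 : 1 ≤ r) (hrl : r ≤ l)
    (a c : Fin l → ℤ) (b d : ℤ)
    (hb : ∑ i ∈ Finset.univ.filter (fun i : Fin l => (i : ℕ) < r), a i ≤ b)
    (hd : ∑ i ∈ Finset.univ.filter (fun i : Fin l => (i : ℕ) < r), c i ≤ d) :
    Qblowup l r (fun i => a i + c i) (b + d) ∩ {z | ∀ i, ∃ m : ℤ, z i = m} =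
      (Qblowup l r a b ∩ {z | ∀ i, ∃ m : ℤ, z i = m}) +
      (Qblowup l r c d ∩ {z | ∀ i, ∃ m : ℤ, z i = m}) := by
  ext z
  constructor
  · rintro ⟨⟨hz, hzsum⟩, hint⟩
    choose m hm using hint
    obtain rfl : z = fun i => (m i : ℝ) := funext hm
    dsimp only at hz hzsum
    have hac : ∀ i, a i + c i ≤ m i := fun i => by exact_mod_cast hz i
    have hsum : b + d ≤ ∑ i ∈ Finset.univ.filter (fun i : Fin l => (i : ℕ) < r), m i := by
      exact_mod_cast hzsum
    obtain ⟨x, hax, hxm, hx⟩ := Finset.exists_sum_eq_of_sum_le_of_le_sum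
      (hi := fun i => m i - c i) _ (fun i => by have := hac i; grind) hb
      (by rw [Finset.sum_sub_distrib]; omega)
    refine ⟨fun i => (x i : ℝ), ⟨⟨fun i => Int.cast_le.2 (hax i), ?_⟩,
      fun i => ⟨x i, rfl⟩⟩, fun i => ((m i - x i : ℤ) : ℝ), ⟨⟨fun i => ?_, ?_⟩,
      fun i => ⟨_, rfl⟩⟩, ?_⟩
    · rw [← Int.cast_sum, Int.cast_le, hx]
    · exact Int.cast_le.2 (le_sub_comm.1 (hxm i))
    · rw [← Int.cast_sum, Int.cast_le, Finset.sum_sub_distrib]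
      omega
    · ext i
      simp
  · rintro ⟨x, ⟨⟨hx, hxsum⟩, hxint⟩, y, ⟨⟨hy, hysum⟩, hyint⟩, rfl⟩
    refine ⟨⟨fun i => ?_, ?_⟩, fun i => ?_⟩
    · simpa using add_le_add (hx i) (hy i)
    · simpa [Finset.sum_add_distrib] using add_le_add hxsum hysum
    · obtain ⟨m, hm⟩ := hxint i
      obtain ⟨n, hn⟩ := hyint i
      exact ⟨m + n, by simp [hm, hn]⟩
end

section
/- Let l ≥ 2 and 2 ≤ r ≤ l. Let a₁,…,a_l and b₂,…,b_r be integers with bᵢ ≥ a_{i−1} + aᵢ for 2 ≤ i ≤ r. Define Q = {z ∈ ℝ^l : zᵢ ≥ aᵢ for all i, and z_{i−1} + zᵢ ≥ bᵢ for 2 ≤ i ≤ r}. Then every z ∈ ℤ^l with zᵢ ≥ 2aᵢ for all i and z_{i−1} + zᵢ ≥ 2bᵢ for 2 ≤ i ≤ r is the sum of two elements of Q ∩ ℤ^l. -/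
/-- The polyhedron `Q = {z ∈ ℝ^l : zᵢ ≥ aᵢ ∀i, z_{i−1} + zᵢ ≥ bᵢ for 2 ≤ i ≤ r}`
(1-based coordinates: `z_i` is `z ⟨i-1⟩`). -/
def Qchain (l r : ℕ) (hl : 2 ≤ l) (hrl : r ≤ l) (a : Fin l → ℤ) (b : ℕ → ℤ) :
    Set (Fin l → ℝ) :=
  {z | (∀ i, (a i : ℝ) ≤ z i) ∧ ∀ i : ℕ, ∀ _h2 : 2 ≤ i, ∀ _hir : i ≤ r,
    (b i : ℝ) ≤ z ⟨i - 2, by omega⟩ + z ⟨i - 1, by omega⟩}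

/-- if `bᵢ ≥ a_{i−1} + aᵢ` for `2 ≤ i ≤ r`, then every lattice point `z`
with `zᵢ ≥ 2aᵢ` and `z_{i−1} + zᵢ ≥ 2bᵢ` is a sum of two lattice points of `Q`. -/
theorem stmt10 (l r : ℕ) (hl : 2 ≤ l) (hr2 : 2 ≤ r) (hrl : r ≤ l)
    (a : Fin l → ℤ) (b : ℕ → ℤ)
    (hb : ∀ i : ℕ, ∀ _h2 : 2 ≤ i, ∀ _hir : i ≤ r,
      a ⟨i - 2, by omega⟩ + a ⟨i - 1, by omega⟩ ≤ b i) :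
    ∀ z : Fin l → ℤ,
      (∀ i, 2 * a i ≤ z i) →
      (∀ i : ℕ, ∀ _h2 : 2 ≤ i, ∀ _hir : i ≤ r,
        2 * b i ≤ z ⟨i - 2, by omega⟩ + z ⟨i - 1, by omega⟩) →
      ∃ x y : Fin l → ℤ,
        (fun i => (x i : ℝ)) ∈ Qchain l r hl hrl a b ∧
        (fun i => (y i : ℝ)) ∈ Qchain l r hl hrl a b ∧
        z = x + y := by
  intro z hza hzb
  -- Halve `z`, rounding down and up alternately along the chain.
  refine ⟨fun i => (z i + (i : ℕ) % 2) / 2, fun i => (z i + 1 - (i : ℕ) % 2) / 2,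
    ⟨fun i => ?_, fun i h2 hir => ?_⟩, ⟨fun i => ?_, fun i h2 hir => ?_⟩, ?_⟩
  · have := hza i
    exact Int.cast_le.mpr (by omega : a i ≤ (z i + (i : ℕ) % 2) / 2)
  · have := hzb i h2 hir
    beta_reduce
    rw [← Int.cast_add, Int.cast_le]
    dsimp only
    omega
  · have := hza i
    exact Int.cast_le.mpr (by omega : a i ≤ (z i + 1 - (i : ℕ) % 2) / 2)
  · have := hzb i h2 hir
    beta_reduce
    rw [← Int.cast_add, Int.cast_le]
    dsimp only
    omega
  · funext i
    simp only [Pi.add_apply]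
    omega
end

section
/- Let a and b be positive integers and define Q = {z ∈ ℝ³ : z₁ ≥ 0, z₂ ≥ 0, z₃ ≥ 0, and a z₁ + a z₂ + z₃ ≥ ab}. Then every z ∈ ℤ³ with z₁, z₂, z₃ ≥ 0 and a z₁ + a z₂ + z₃ ≥ 2ab is the sum of two elements of Q ∩ ℤ³. -/
/-- for positive integers `a, b` and
`Q = {z ∈ ℝ³ : z₁, z₂, z₃ ≥ 0, a z₁ + a z₂ + z₃ ≥ ab}`, every lattice point `z ∈ ℤ³` with
`z₁, z₂, z₃ ≥ 0` and `a z₁ + a z₂ + z₃ ≥ 2ab` is a sum of two lattice points of `Q`. -/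
theorem stmt11 (a b : ℤ) (ha : 0 < a) (hb : 0 < b)
    (Q : Set (Fin 3 → ℝ))
    (hQ : Q = {z : Fin 3 → ℝ | 0 ≤ z 0 ∧ 0 ≤ z 1 ∧ 0 ≤ z 2 ∧
      ((a * b : ℤ) : ℝ) ≤ (a : ℝ) * z 0 + (a : ℝ) * z 1 + z 2}) :
    ∀ z : Fin 3 → ℤ, 0 ≤ z 0 → 0 ≤ z 1 → 0 ≤ z 2 →
      2 * a * b ≤ a * z 0 + a * z 1 + z 2 →
      ∃ x y : Fin 3 → ℤ,
        (fun i => (x i : ℝ)) ∈ Q ∧ (fun i => (y i : ℝ)) ∈ Q ∧ z = x + y := by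
  intro z h0 h1 h2 h
  subst hQ
  suffices key : ∃ p q r : ℤ, (0 ≤ p ∧ 0 ≤ q ∧ 0 ≤ r ∧ a * b ≤ a * p + a * q + r) ∧
      (0 ≤ z 0 - p ∧ 0 ≤ z 1 - q ∧ 0 ≤ z 2 - r ∧
        a * b ≤ a * (z 0 - p) + a * (z 1 - q) + (z 2 - r)) by
    obtain ⟨p, q, r, hx, hy⟩ := key
    refine ⟨![p, q, r], ![z 0 - p, z 1 - q, z 2 - r], ?_, ?_, ?_⟩
    · simp only [Set.mem_ofPred_eq, Matrix.cons_val]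
      exact_mod_cast hx
    · simp only [Set.mem_ofPred_eq, Matrix.cons_val]
      exact_mod_cast hy
    · ext i
      fin_cases i <;> simp
  by_cases hs : b ≤ z 0 + z 1
  · obtain ⟨p, hp0, hpz, hpb, hpq⟩ : ∃ p, 0 ≤ p ∧ p ≤ z 0 ∧ p ≤ b ∧ b - p ≤ z 1 :=
      ⟨min (z 0) b, by omega, by omega, by omega, by omega⟩
    refine ⟨p, b - p, 0, ⟨hp0, by linarith, le_rfl, by linarith⟩,
      by linarith, by linarith, by linarith, by linarith⟩
  · have hab : 0 < a * b := mul_pos ha hb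
    have has : a * (z 0 + z 1) ≤ a * b := by gcongr; omega
    refine ⟨z 0, z 1, a * b - a * (z 0 + z 1), ⟨h0, h1, by linarith, by linarith⟩,
      by linarith, by linarith, by linarith, by linarith⟩
end

section
/- Let m ≥ 1 and let a, b, c, d be integers with 0 ≤ a ≤ b and 0 ≤ c ≤ d. Then every y ∈ ℤ^m with yᵢ ≥ 0 for all i and a + c ≤ y₁ + ⋯ + y_m ≤ b + d can be written y = y' + y'' with y', y'' ∈ ℤ^m, y'ᵢ ≥ 0 and y''ᵢ ≥ 0 for all i, a ≤ y'₁ + ⋯ + y'_m ≤ b, and c ≤ y''₁ + ⋯ + y''_m ≤ d. -/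
/-- A nonnegative integer vector dominates a nonnegative integer vector of any prescribed sum
between `0` and its own sum. -/
theorem exists_nonneg_le_sum_eq {n : ℕ} (y : Fin n → ℤ) (hy : ∀ i, 0 ≤ y i) (s : ℤ)
    (hs : 0 ≤ s) (hsy : s ≤ ∑ i, y i) :
    ∃ x : Fin n → ℤ, (∀ i, 0 ≤ x i) ∧ (∀ i, x i ≤ y i) ∧ ∑ i, x i = s := by
  induction n generalizing s with
  | zero => exact ⟨y, hy, fun _ => le_rfl, by simp at hsy ⊢; omega⟩
  | succ n ih =>
    rw [Fin.sum_univ_succ] at hsy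
    have h0 := hy 0
    obtain ⟨x, hx, hxy, hsum⟩ :=
      ih (fun i => y i.succ) (fun i => hy i.succ) (s - min s (y 0)) (by omega)
        (by have := Finset.sum_nonneg fun i (_ : i ∈ Finset.univ) => hy (Fin.succ i)
            omega)
    refine ⟨Fin.cons (min s (y 0)) x, Fin.forall_fin_succ.2 ⟨?_, ?_⟩,
      Fin.forall_fin_succ.2 ⟨?_, ?_⟩, ?_⟩
    · simpa using ⟨hs, h0⟩
    · simpa using hx
    · simp
    · simpa using hxy
    · rw [Fin.sum_univ_succ]
      simp [hsum]

/-- for integers `0 ≤ a ≤ b`, `0 ≤ c ≤ d`, every `y ∈ ℤ^m` with `yᵢ ≥ 0` and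
`a + c ≤ Σ yᵢ ≤ b + d` decomposes as `y = y' + y''` with `y'ᵢ, y''ᵢ ≥ 0`,
`a ≤ Σ y'ᵢ ≤ b` and `c ≤ Σ y''ᵢ ≤ d`. -/
theorem stmt12 (m : ℕ) (hm : 1 ≤ m) (a b c d : ℤ)
    (ha : 0 ≤ a) (hab : a ≤ b) (hc : 0 ≤ c) (hcd : c ≤ d) :
    ∀ y : Fin m → ℤ, (∀ i, 0 ≤ y i) → a + c ≤ ∑ i, y i → ∑ i, y i ≤ b + d →
      ∃ y' y'' : Fin m → ℤ,
        (∀ i, 0 ≤ y' i) ∧ (∀ i, 0 ≤ y'' i) ∧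
        a ≤ ∑ i, y' i ∧ ∑ i, y' i ≤ b ∧
        c ≤ ∑ i, y'' i ∧ ∑ i, y'' i ≤ d ∧
        y = y' + y'' := by
  intro y hy hlo hhi
  obtain ⟨x, hx, hxy, hsum⟩ :=
    exists_nonneg_le_sum_eq y hy (max a (∑ i, y i - d)) (by omega) (by omega)
  have hdiff : ∑ i, (y - x) i = ∑ i, y i - ∑ i, x i := by simp
  exact ⟨x, y - x, hx, fun i => sub_nonneg.2 (hxy i), by omega, by omega, by omega, by omega,
    (add_sub_cancel x y).symm⟩
end
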